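/- arXiv:2108.09057 — 3 statements merged into one kernel-verified Lean document; each statement's English description precedes it below -/
import Mathlib

section
/- If G is a graph on n vertices with m edges that does not contain two edge-disjoint cycles, then m ≤ n + 3. -/
open Classical in
/-- Adjacency matrix of a simple graph over ℝ. -/
noncomputable def adjMat {V : Type*} [Fintype V] (G : SimpleGraph V) : Matrix V V ℝ :=
  Matrix.of fun i j => if G.Adj i j then (1 : ℝ) else 0

/-- Spectral radius: largest adjacency eigenvalue. -/
noncomputable def specRad {V : Type*} [Fintype V] (G : SimpleGraph V) : ℝ :=
  sSup {t : ℝ | ∃ x : V → ℝ, x ≠ 0 ∧ (adjMat G).mulVec x = t • x}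

/-- `G` contains two edge-disjoint cycles. -/
def HasTwoEdgeDisjointCycles {V : Type*} (G : SimpleGraph V) : Prop :=
  ∃ (u v : V) (c₁ : G.Walk u u) (c₂ : G.Walk v v),
    c₁.IsCycle ∧ c₂.IsCycle ∧ ∀ e ∈ c₁.edges, e ∉ c₂.edges

/-- `G` contains two distinct cycles (as subgraphs) of the same length. -/
def HasTwoCyclesSameLength {V : Type*} [DecidableEq V] (G : SimpleGraph V) : Prop :=
  ∃ (u v : V) (c₁ : G.Walk u u) (c₂ : G.Walk v v),
    c₁.IsCycle ∧ c₂.IsCycle ∧ c₁.length = c₂.length ∧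
      c₁.edges.toFinset ≠ c₂.edges.toFinset

/-- The edge set of a triangle given by a triple of vertices. -/
def triEdges {V : Type*} (t : V × V × V) : Set (Sym2 V) :=
  {s(t.1, t.2.1), s(t.2.1, t.2.2), s(t.1, t.2.2)}

/-- `G` contains `k` pairwise edge-disjoint triangles. -/
def HasEdgeDisjointTriangles {V : Type*} (G : SimpleGraph V) (k : ℕ) : Prop :=
  ∃ T : Fin k → V × V × V,
    (∀ i, G.Adj (T i).1 (T i).2.1 ∧ G.Adj (T i).2.1 (T i).2.2 ∧ G.Adj (T i).1 (T i).2.2) ∧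
    ∀ i j, i ≠ j → Disjoint (triEdges (T i)) (triEdges (T j))

/-- The star `K_{1,n-1}` (center `0`) plus an edge between the leaves `1` and `2`. -/
def starPlus (n : ℕ) : SimpleGraph (Fin n) :=
  SimpleGraph.fromRel (fun x y => x.val = 0 ∨ (x.val < 3 ∧ y.val < 3))

/-- `K₄ • K_{1,n-4}`: `K₄` on `{0,1,2,3}` with `0` joined to everything. -/
def K4Star (n : ℕ) : SimpleGraph (Fin n) :=
  SimpleGraph.fromRel (fun x y => x.val = 0 ∨ (x.val < 4 ∧ y.val < 4))

/-- `K_{3,3} • K_{1,n-6}`: `K_{3,3}` with parts `{0,1,2}`, `{3,4,5}`, and the vertex `0`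
identified with the center of a star with leaves `6,…,n-1`. -/
def K33Star (n : ℕ) : SimpleGraph (Fin n) :=
  SimpleGraph.fromRel (fun x y =>
    (x.val < 3 ∧ 3 ≤ y.val ∧ y.val < 6) ∨ (x.val = 0 ∧ 6 ≤ y.val))

/-- `K_{⌈n/2⌉,⌊n/2⌋}` with a star `K_{1,k-1}` (center `0`, leaves `1,…,k-1`) embedded
in the part `{0,…,⌊n/2⌋-1}` of size `⌊n/2⌋`. -/
def bipStar (n k : ℕ) : SimpleGraph (Fin n) :=
  SimpleGraph.fromRel (fun x y =>
    (x.val < n / 2 ∧ n / 2 ≤ y.val) ∨ (x.val = 0 ∧ 0 < y.val ∧ y.val < k))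

/-- `K_{⌈n/2⌉,⌊n/2⌋}` with a triangle `C₃` on `{0,1,2}` embedded in the part of size `⌊n/2⌋`. -/
def bipTri (n : ℕ) : SimpleGraph (Fin n) :=
  SimpleGraph.fromRel (fun x y =>
    (x.val < n / 2 ∧ n / 2 ≤ y.val) ∨ (x.val < 3 ∧ y.val < 3))

/-- `v` is a cut vertex of `G`. -/
def IsCutVertex {V : Type*} (G : SimpleGraph V) (v : V) : Prop :=
  ∃ a b : ({v}ᶜ : Set V), G.Reachable ↑a ↑b ∧ ¬ (G.induce ({v}ᶜ : Set V)).Reachable a b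

namespace SimpleGraph

variable {V : Type*} {G : SimpleGraph V}

lemma exists_isCycle_of_not_isAcyclic (h : ¬ G.IsAcyclic) :
    ∃ (u : V) (c : G.Walk u u), c.IsCycle := by
  simpa [IsAcyclic] using h

lemma hasTwoEdgeDisjointCycles_mono {H : SimpleGraph V} (hle : H ≤ G)
    (h : HasTwoEdgeDisjointCycles H) : HasTwoEdgeDisjointCycles G := by
  obtain ⟨u, v, c₁, c₂, h₁, h₂, hd⟩ := h
  refine ⟨u, v, c₁.mapLe hle, c₂.mapLe hle, h₁.mapLe hle, h₂.mapLe hle, ?_⟩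
  simpa [Walk.edges_mapLe_eq_edges] using hd

open Classical in
lemma IsAcyclic.ncard_edgeSet_lt [Fintype V] (h : G.IsAcyclic) {S : Finset V}
    (hS : S.Nonempty) (hG : G.support ⊆ S) : G.edgeSet.ncard < S.card := by
  have : Nonempty (S : Set V) := hS.to_subtype
  obtain ⟨T, hle, -, hT⟩ :=
    (connected_top (V := (S : Set V))).exists_isTree_le_of_le_of_isAcyclic le_top (h.induce S)
  have h₁ := hT.card_edgeFinset
  have h₂ := G.card_edgeFinset_induce_of_support_subset hG
  have h₃ := Finset.card_le_card (edgeFinset_mono hle)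
  have h₄ : Fintype.card (S : Set V) = S.card := by simp
  have h₅ : (G.induce S).edgeFinset.card = G.edgeFinset.card := by convert h₂
  rw [← coe_edgeFinset, Set.ncard_coe_finset]
  omega

lemma hasTwoEdgeDisjointCycles_of_short_cycle [Fintype V] {S : Finset V} (hG : G.support ⊆ S)
    (hcard : S.card + 4 ≤ G.edgeSet.ncard) {u : V} {c : G.Walk u u} (hc : c.IsCycle)
    (hlen : c.length ≤ 4) : HasTwoEdgeDisjointCycles G := by
  have hS : S.Nonempty := ⟨u, hG ⟨c.snd, c.adj_snd hc.not_nil⟩⟩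
  have hle : G.deleteEdges {e | e ∈ c.edges} ≤ G := deleteEdges_le _
  have hna : ¬ (G.deleteEdges {e | e ∈ c.edges}).IsAcyclic := by
    intro hac
    have h₁ := hac.ncard_edgeSet_lt hS ((support_mono hle).trans hG)
    rw [edgeSet_deleteEdges] at h₁
    have h₂ := Set.le_ncard_sdiff {e | e ∈ c.edges} G.edgeSet (Set.toFinite _)
    have h₃ : {e | e ∈ c.edges}.ncard ≤ 4 := by
      classical
      have : {e | e ∈ c.edges} = (c.edges.toFinset : Set (Sym2 V)) := by ext; simp
      rw [this, Set.ncard_coe_finset]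
      exact (List.toFinset_card_le _).trans (by simpa using hlen)
    omega
  obtain ⟨v, d, hd⟩ := exists_isCycle_of_not_isAcyclic hna
  refine ⟨u, v, c, d.mapLe hle, hc, hd.mapLe hle, fun e he he' ↦ ?_⟩
  rw [Walk.edges_mapLe_eq_edges] at he'
  have := d.edges_subset_edgeSet he'
  simp_all [edgeSet_deleteEdges]

/-- A cycle of the graph obtained by suppressing a vertex `x` of degree two lifts to a cycle of the
original graph. -/
lemma exists_isCycle_of_suppress {x u v : V} (hu : G.Adj x u) (hv : G.Adj x v) (huv : u ≠ v)
    {w : V} {c : (G.deleteIncidenceSet x ⊔ edge u v).Walk w w} (hc : c.IsCycle) :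
    ∃ (w' : V) (d : G.Walk w' w'), d.IsCycle ∧
      ∀ e ∈ d.edges, (e ∈ c.edges ∧ x ∉ e) ∨ (x ∈ e ∧ s(u, v) ∈ c.edges) := by
  have hedge : ∀ e ∈ c.edges, e ≠ s(u, v) → e ∈ G.edgeSet ∧ x ∉ e := by
    intro e he hne
    have := c.edges_subset_edgeSet he
    induction e with | _ a b =>
    simp only [mem_edgeSet, sup_adj, deleteIncidenceSet_adj, edge_adj, Sym2.mem_iff, ne_eq,
      Sym2.eq_iff] at this hne ⊢
    grind
  by_cases hmem : s(u, v) ∈ c.edges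
  · set K : SimpleGraph V :=
      fromEdgeSet ({e | e ∈ c.edges ∧ e ≠ s(u, v)} ∪ {s(u, x), s(x, v)}) with hK
    have hKG : K ≤ G := by
      intro a b hab
      simp only [hK, fromEdgeSet_adj, Set.mem_union, Set.mem_insert_iff, Set.mem_singleton_iff,
        Set.mem_ofPred_eq] at hab
      rcases hab.1 with h | h | h
      · exact (hedge _ h.1 h.2).1
      · rw [← mem_edgeSet, h]; exact hu.symm
      · rw [← mem_edgeSet, h]; exact hv
    have hKna : ¬ K.IsAcyclic := by
      intro hac
      have hKux : K.Adj u x := by simp [hK, hu.ne']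
      have hbr := isAcyclic_iff_forall_adj_isBridge.1 hac hKux
      rw [isBridge_iff] at hbr
      apply hbr
      set L : SimpleGraph V := fromEdgeSet {e | e ∈ c.edges} with hL
      have hcL : ∀ e ∈ c.edges, e ∈ L.edgeSet := by
        intro e he
        rw [hL, edgeSet_fromEdgeSet]
        exact ⟨he, not_isDiag_of_mem_edgeSet _ (c.edges_subset_edgeSet he)⟩
      have hLb : ¬ L.IsBridge s(u, v) := by
        rw [isBridge_iff_forall_cycle_notMem (hcL _ hmem)]
        intro hcyc
        exact hcyc _ (hc.transfer hcL) (by rwa [Walk.edges_transfer])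
      rw [isBridge_iff, not_not] at hLb
      have hle : L.deleteEdges {s(u, v)} ≤ K.deleteEdges {s(u, x)} := by
        intro a b hab
        simp only [deleteEdges_adj, hL, hK, fromEdgeSet_adj, Set.mem_union, Set.mem_insert_iff,
          Set.mem_singleton_iff, Set.mem_ofPred_eq] at hab ⊢
        refine ⟨⟨Or.inl ⟨hab.1.1, hab.2⟩, hab.1.2⟩, fun h ↦ (hedge _ hab.1.1 hab.2).2 ?_⟩
        rw [h]; simp
      refine (hLb.mono hle).trans (Adj.reachable ?_)
      have h₁ := hv.ne
      have h₂ := hu.ne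
      simp only [deleteEdges_adj, hK, fromEdgeSet_adj, Set.mem_union, Set.mem_insert_iff,
        Set.mem_singleton_iff, Set.mem_ofPred_eq, Sym2.eq_iff]
      grind
    obtain ⟨w', d, hd⟩ := exists_isCycle_of_not_isAcyclic hKna
    refine ⟨w', d.mapLe hKG, hd.mapLe hKG, fun e he ↦ ?_⟩
    rw [Walk.edges_mapLe_eq_edges] at he
    have he := d.edges_subset_edgeSet he
    rw [hK, edgeSet_fromEdgeSet] at he
    rcases he.1 with h | h | h
    · exact Or.inl ⟨h.1, (hedge _ h.1 h.2).2⟩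
    · exact Or.inr ⟨by simp [h], hmem⟩
    · exact Or.inr ⟨by simp_all, hmem⟩
  · have hcG : ∀ e ∈ c.edges, e ∈ G.edgeSet ∧ x ∉ e := fun e he ↦
      hedge e he fun h ↦ hmem (h ▸ he)
    refine ⟨w, c.transfer G fun e he ↦ (hcG e he).1, hc.transfer _, fun e he ↦ ?_⟩
    rw [Walk.edges_transfer] at he
    exact Or.inl ⟨he, (hcG e he).2⟩

lemma hasTwoEdgeDisjointCycles_of_suppress {x u v : V} (hu : G.Adj x u) (hv : G.Adj x v)
    (huv : u ≠ v) (h : HasTwoEdgeDisjointCycles (G.deleteIncidenceSet x ⊔ edge u v)) :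
    HasTwoEdgeDisjointCycles G := by
  obtain ⟨_, _, c₁, c₂, h₁, h₂, hd⟩ := h
  obtain ⟨w₁, d₁, hd₁, hc₁⟩ := exists_isCycle_of_suppress hu hv huv h₁
  obtain ⟨w₂, d₂, hd₂, hc₂⟩ := exists_isCycle_of_suppress hu hv huv h₂
  exact ⟨w₁, w₂, d₁, d₂, hd₁, hd₂, by grind⟩

open Classical in
/-- The Moore bound for minimum degree three and girth five. -/
lemma ten_le_card_of_three_le_degree [Fintype V] {S : Finset V} (hS : S.Nonempty)
    (hG : G.support ⊆ S) (hdeg : ∀ x ∈ S, 3 ≤ G.degree x)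
    (h₃ : ∀ a b c, G.Adj a b → G.Adj b c → ¬ G.Adj c a)
    (h₄ : ∀ a b c d, G.Adj a b → G.Adj b c → G.Adj c d → G.Adj d a → a ≠ c → b = d) :
    10 ≤ S.card := by
  obtain ⟨x, hx⟩ := hS
  set B := (G.neighborFinset x).biUnion fun y ↦ (G.neighborFinset y).erase x with hB
  have hBcard : 6 ≤ B.card := by
    rw [hB, Finset.card_biUnion]
    · calc 6 ≤ (G.neighborFinset x).card * 2 := by
            have := hdeg x hx
            rw [card_neighborFinset_eq_degree]; omega
        _ ≤ _ := Finset.card_nsmul_le_sum _ _ 2 fun y hy ↦ by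
            rw [mem_neighborFinset] at hy
            have := hdeg y (hG ⟨x, hy.symm⟩)
            rw [Finset.card_erase_of_mem (by simpa using hy.symm), card_neighborFinset_eq_degree]
            omega
    · intro y hy z hz hyz
      refine Finset.disjoint_left.2 fun a ha hb ↦ ?_
      simp only [Finset.mem_coe, mem_neighborFinset, Finset.mem_erase] at hy hz ha hb
      exact hyz (h₄ x y a z hy ha.2 hb.2.symm hz.symm ha.1.symm)
  have hdisj : Disjoint (G.neighborFinset x) B := by
    rw [Finset.disjoint_left]
    intro a ha hb
    simp only [hB, mem_neighborFinset, Finset.mem_erase, Finset.mem_biUnion] at ha hb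
    obtain ⟨y, hy, -, hya⟩ := hb
    exact h₃ x y a hy hya ha.symm
  have hxn : x ∉ G.neighborFinset x ∪ B := by simp [hB]
  have hsub : insert x (G.neighborFinset x ∪ B) ⊆ S := by
    intro a ha
    simp only [hB, mem_neighborFinset, Finset.mem_erase, Finset.mem_biUnion, Finset.mem_insert,
      Finset.mem_union] at ha
    rcases ha with rfl | ha | ⟨y, -, -, ha⟩
    · exact hx
    · exact hG ⟨x, ha.symm⟩
    · exact hG ⟨y, ha.symm⟩
  have hcard := Finset.card_le_card hsub
  rw [Finset.card_insert_of_notMem hxn, Finset.card_union_of_disjoint hdisj,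
    card_neighborFinset_eq_degree] at hcard
  have := hdeg x hx
  omega

lemma exists_isCycle_of_triangle {a b c : V} (hab : G.Adj a b) (hbc : G.Adj b c)
    (hca : G.Adj c a) : ∃ p : G.Walk a a, p.IsCycle ∧ p.length ≤ 4 := by
  refine ⟨.cons hab (.cons hbc (.cons hca .nil)), ?_, by simp⟩
  have := hab.ne
  have := hbc.ne
  have := hca.ne
  simp [Walk.cons_isCycle_iff, Walk.cons_isPath_iff]
  grind

lemma exists_isCycle_of_square {a b c d : V} (hab : G.Adj a b) (hbc : G.Adj b c)
    (hcd : G.Adj c d) (hda : G.Adj d a) (hac : a ≠ c) (hbd : b ≠ d) :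
    ∃ p : G.Walk a a, p.IsCycle ∧ p.length ≤ 4 := by
  refine ⟨.cons hab (.cons hbc (.cons hcd (.cons hda .nil))), ?_, by simp⟩
  have := hab.ne
  have := hbc.ne
  have := hcd.ne
  have := hda.ne
  simp [Walk.cons_isCycle_iff, Walk.cons_isPath_iff]
  grind

open Classical in
lemma ncard_edgeSet_deleteIncidenceSet [Fintype V] (x : V) :
    (G.deleteIncidenceSet x).edgeSet.ncard = G.edgeSet.ncard - G.degree x := by
  rw [← coe_edgeFinset, ← coe_edgeFinset, Set.ncard_coe_finset, Set.ncard_coe_finset,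
    ← card_edgeFinset_deleteIncidenceSet]

open Classical in
lemma hasTwoEdgeDisjointCycles_of_le_ncard_edgeSet [Fintype V] (S : Finset V)
    (hG : G.support ⊆ S) (hcard : S.card + 4 ≤ G.edgeSet.ncard) :
    HasTwoEdgeDisjointCycles G := by
  induction hN : S.card + G.edgeSet.ncard using Nat.strong_induction_on generalizing G S with
  | _ N ih =>
  subst hN
  have hne : G.edgeSet.Nonempty := Set.nonempty_of_ncard_ne_zero (by omega)
  by_cases hlt : S.card + 4 < G.edgeSet.ncard
  · obtain ⟨e, he⟩ := hne
    have hle : G.deleteEdges {e} ≤ G := deleteEdges_le _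
    have hc : (G.deleteEdges {e}).edgeSet.ncard = G.edgeSet.ncard - 1 := by
      rw [edgeSet_deleteEdges, Set.ncard_sdiff_singleton_of_mem he]
    exact hasTwoEdgeDisjointCycles_mono hle
      (ih _ (by omega) S ((support_mono hle).trans hG) (by omega) rfl)
  by_contra hno
  have hshort : ∀ {a : V} (p : G.Walk a a), p.IsCycle → ¬ p.length ≤ 4 := fun p hp hlen ↦
    hno (hasTwoEdgeDisjointCycles_of_short_cycle hG hcard hp hlen)
  have h₃ : ∀ a b c, G.Adj a b → G.Adj b c → ¬ G.Adj c a := by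
    intro a b c hab hbc hca
    obtain ⟨p, hp, hlen⟩ := exists_isCycle_of_triangle hab hbc hca
    exact hshort p hp hlen
  have h₄ : ∀ a b c d, G.Adj a b → G.Adj b c → G.Adj c d → G.Adj d a → a ≠ c → b = d := by
    intro a b c d hab hbc hcd hda hac
    by_contra hbd
    obtain ⟨p, hp, hlen⟩ := exists_isCycle_of_square hab hbc hcd hda hac hbd
    exact hshort p hp hlen
  have hdel : ∀ x, (G.deleteIncidenceSet x).support ⊆ (S.erase x : Finset V) := fun x ↦
    (G.support_deleteIncidenceSet_subset x).trans (by
      rw [Finset.coe_erase]; exact Set.sdiff_subset_sdiff_left hG)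
  have hdeg : ∀ x ∈ S, 3 ≤ G.degree x := by
    intro x hx
    by_contra! hlt3
    have hSx := Finset.card_erase_of_mem hx
    have hSpos := Finset.card_pos.2 ⟨x, hx⟩
    have hEx := G.ncard_edgeSet_deleteIncidenceSet x
    by_cases h2 : G.degree x = 2
    · rw [← card_neighborFinset_eq_degree, Finset.card_eq_two] at h2
      obtain ⟨u, v, huv, hnb⟩ := h2
      have hu : G.Adj x u := by rw [← mem_neighborFinset, hnb]; simp
      have hv : G.Adj x v := by rw [← mem_neighborFinset, hnb]; simp
      have hnuv : ¬ G.Adj u v := fun h ↦ h₃ x u v hu h hv.symm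
      have hdx : G.degree x = 2 := by
        rw [← card_neighborFinset_eq_degree, hnb, Finset.card_pair huv]
      have hE : (G.deleteIncidenceSet x ⊔ edge u v).edgeSet.ncard = G.edgeSet.ncard - 1 := by
        rw [edgeSet_sup, edgeSet_edge_of_ne huv, Set.union_singleton, Set.ncard_insert_of_notMem]
        · omega
        · simp [deleteIncidenceSet_adj, hnuv]
      refine hno (hasTwoEdgeDisjointCycles_of_suppress hu hv huv
        (ih _ ?_ (S.erase x) ?_ ?_ rfl))
      · omega
      · rintro a ⟨b, hab⟩
        rcases sup_adj .. |>.1 hab with hab | hab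
        · exact hdel x ⟨b, hab⟩
        · have hux := hG ⟨x, hu.symm⟩
          have hvx := hG ⟨x, hv.symm⟩
          have := hu.ne
          have := hv.ne
          rw [edge_adj] at hab
          simp only [Finset.coe_erase, Set.mem_sdiff, Set.mem_singleton_iff]
          grind
      · omega
    · exact hno (hasTwoEdgeDisjointCycles_mono (G.deleteIncidenceSet_le x)
        (ih _ (by omega) (S.erase x) (hdel x) (by omega) rfl))
  have hS : S.Nonempty := by
    obtain ⟨e, he⟩ := hne
    induction e with | _ a b => exact ⟨a, hG ⟨b, he⟩⟩
  have h10 := ten_le_card_of_three_le_degree hS hG hdeg h₃ h₄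
  have hsum := G.sum_degrees_eq_twice_card_edges
  have hle : S.card * 3 ≤ ∑ v, G.degree v :=
    (Finset.card_nsmul_le_sum S _ 3 hdeg).trans
      (Finset.sum_le_sum_of_subset (Finset.subset_univ S))
  rw [← Set.ncard_coe_finset, coe_edgeFinset] at hsum
  omega

end SimpleGraph

theorem stmt0 {V : Type*} [Fintype V] [DecidableEq V] (G : SimpleGraph V)
    [DecidableRel G.Adj] (n m : ℕ) (hn : Fintype.card V = n)
    (hm : G.edgeFinset.card = m) (h : ¬ HasTwoEdgeDisjointCycles G) :
    m ≤ n + 3 := by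
  by_contra! hlt
  refine h (SimpleGraph.hasTwoEdgeDisjointCycles_of_le_ncard_edgeSet Finset.univ (by simp) ?_)
  rw [← SimpleGraph.coe_edgeFinset, Set.ncard_coe_finset, Finset.card_univ]
  omega
end

section
/- Every graph G of order n ≥ 26 with ρ(G) ≥ ρ(K_{1,n−1}^+) contains two cycles of the same length, unless G is isomorphic to K_{1,n−1}^+. -/
namespace SimpleGraph

variable {V : Type*} {G : SimpleGraph V}

theorem exists_cycle_three {a b c : V} (hab : G.Adj a b) (hbc : G.Adj b c) (hca : G.Adj c a) :
    ∃ p : G.Walk a a, p.IsCycle ∧ p.length = 3 ∧ p.edges = [s(a, b), s(b, c), s(c, a)] := by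
  refine ⟨.cons hab (.cons hbc (.cons hca .nil)), ?_, by simp, by simp⟩
  have h1 := hab.ne
  have h2 := hbc.ne
  have h3 := hca.ne
  simp [Walk.cons_isCycle_iff, Walk.cons_isPath_iff]
  grind

theorem exists_cycle_four {a b c d : V} (hab : G.Adj a b) (hbc : G.Adj b c) (hcd : G.Adj c d)
    (hda : G.Adj d a) (hac : a ≠ c) (hbd : b ≠ d) :
    ∃ p : G.Walk a a, p.IsCycle ∧ p.length = 4 ∧
      p.edges = [s(a, b), s(b, c), s(c, d), s(d, a)] := by
  refine ⟨.cons hab (.cons hbc (.cons hcd (.cons hda .nil))), ?_, by simp, by simp⟩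
  have h1 := hab.ne
  have h2 := hbc.ne
  have h3 := hcd.ne
  have h4 := hda.ne
  simp [Walk.cons_isCycle_iff, Walk.cons_isPath_iff]
  grind

theorem exists_cycle_five {a b c d e : V} (hab : G.Adj a b) (hbc : G.Adj b c) (hcd : G.Adj c d)
    (hde : G.Adj d e) (hea : G.Adj e a) (hnd : [a, b, c, d, e].Nodup) :
    ∃ p : G.Walk a a, p.IsCycle ∧ p.length = 5 ∧
      p.edges = [s(a, b), s(b, c), s(c, d), s(d, e), s(e, a)] := by
  refine ⟨.cons hab (.cons hbc (.cons hcd (.cons hde (.cons hea .nil)))), ?_, by simp, by simp⟩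
  simp at hnd
  simp [Walk.cons_isCycle_iff, Walk.cons_isPath_iff]
  grind

theorem exists_cycle_six {a b c d e f : V} (hab : G.Adj a b) (hbc : G.Adj b c) (hcd : G.Adj c d)
    (hde : G.Adj d e) (hef : G.Adj e f) (hfa : G.Adj f a) (hnd : [a, b, c, d, e, f].Nodup) :
    ∃ p : G.Walk a a, p.IsCycle ∧ p.length = 6 ∧
      p.edges = [s(a, b), s(b, c), s(c, d), s(d, e), s(e, f), s(f, a)] := by
  refine ⟨.cons hab (.cons hbc (.cons hcd (.cons hde (.cons hef (.cons hfa .nil))))), ?_,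
    by simp, by simp⟩
  simp at hnd
  simp [Walk.cons_isCycle_iff, Walk.cons_isPath_iff]
  grind

/-- Ordered pairs in `A × B` that are adjacent in `G`. -/
def adjPairs (G : SimpleGraph V) [DecidableRel G.Adj] (A B : Finset V) : Finset (V × V) :=
  (A ×ˢ B).filter fun q => G.Adj q.1 q.2

theorem mem_adjPairs [DecidableRel G.Adj] {A B : Finset V} {q : V × V} :
    q ∈ G.adjPairs A B ↔ (q.1 ∈ A ∧ q.2 ∈ B) ∧ G.Adj q.1 q.2 := by
  simp [adjPairs]

/-- `N` is the neighbourhood of `u`, the vertices of `W₂` are at distance two from `u` with `p w`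
a common neighbour, and those of `W₃` are at distance at least three. -/
structure Layers (G : SimpleGraph V) (u : V) (N W₂ W₃ : Finset V) (p : V → V) : Prop where
  mem_N : ∀ v, v ∈ N ↔ G.Adj u v
  mem_W₂ : ∀ w ∈ W₂, w ≠ u ∧ ¬ G.Adj u w ∧ G.Adj u (p w) ∧ G.Adj w (p w)
  mem_W₃ : ∀ z ∈ W₃, z ≠ u ∧ ¬ G.Adj u z ∧ ∀ v, G.Adj u v → ¬ G.Adj z v

theorem Layers.disjoint_W₂_W₃ {u : V} {N W₂ W₃ : Finset V} {p : V → V}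
    (L : Layers G u N W₂ W₃ p) : Disjoint W₂ W₃ := by
  rw [Finset.disjoint_left]
  intro w h2 h3
  exact (L.mem_W₃ w h3).2.2 _ (L.mem_W₂ w h2).2.2.1 (L.mem_W₂ w h2).2.2.2

theorem sum_adjPairs [DecidableRel G.Adj] (A B : Finset V) (g : V × V → ℝ) :
    ∑ q ∈ G.adjPairs A B, g q = ∑ w ∈ A, ∑ v ∈ B, if G.Adj w v then g (w, v) else 0 := by
  rw [adjPairs, Finset.sum_filter, Finset.sum_product]

theorem sum_adjPairs_swap [DecidableRel G.Adj] (A B : Finset V) (g : V × V → ℝ) :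
    ∑ q ∈ G.adjPairs A B, g q = ∑ q ∈ G.adjPairs B A, g q.swap := by
  rw [sum_adjPairs, sum_adjPairs, Finset.sum_comm]
  simp [G.adj_comm]

/-- `y` is a nonnegative vector with `l * y ≤ A y` and maximal entry `y u = 1`. -/
structure SubEigen [Fintype V] (G : SimpleGraph V) [DecidableRel G.Adj] (l : ℝ) (y : V → ℝ)
    (u : V) : Prop where
  nonneg : ∀ v, 0 ≤ y v
  le_one : ∀ v, y v ≤ 1
  eq_one : y u = 1
  mul_le : ∀ w, l * y w ≤ ∑ v, if G.Adj w v then y v else 0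

theorem SubEigen.sum_adj_le [Fintype V] [DecidableRel G.Adj] {l : ℝ} {y : V → ℝ} {u : V}
    (hy : SubEigen G l y u) (A : Finset V) (v : V) :
    (∑ w ∈ A, if G.Adj v w then y w else 0) ≤ ∑ w ∈ A, y w := by
  refine Finset.sum_le_sum fun w _ => ?_
  split_ifs
  · exact le_rfl
  · exact hy.nonneg w

theorem exists_subEigen_of_mulVec_eq [Fintype V] [DecidableRel G.Adj]
    {x : V → ℝ} {t : ℝ} (hx : x ≠ 0) (ht : 0 ≤ t)
    (h : (adjMat G).mulVec x = t • x) : ∃ y u, SubEigen G t y u := by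
  obtain ⟨v₀, hv₀⟩ := Function.ne_iff.1 hx
  obtain ⟨u, -, hu⟩ := Finset.exists_max_image Finset.univ (fun v => |x v|) ⟨v₀, Finset.mem_univ _⟩
  have hpos : 0 < |x u| := (abs_pos.2 hv₀).trans_le (hu v₀ (Finset.mem_univ _))
  refine ⟨fun v => |x v| / |x u|, u, fun v => by positivity,
    fun v => div_le_one_of_le₀ (hu v (Finset.mem_univ _)) hpos.le, div_self hpos.ne', fun w => ?_⟩
  have hw : ∑ v, (if G.Adj w v then x v else 0) = t * x w := by
    have := congrFun h w
    simpa [adjMat, Matrix.mulVec, dotProduct] using this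
  calc t * (|x w| / |x u|) = |t * x w| / |x u| := by rw [abs_mul, abs_of_nonneg ht, mul_div_assoc]
    _ ≤ (∑ v, |if G.Adj w v then x v else 0|) / |x u| := by
        rw [← hw]
        gcongr
        exact Finset.abs_sum_le_sum_abs _ _
    _ = _ := by
        rw [Finset.sum_div]
        refine Finset.sum_congr rfl fun v _ => ?_
        split_ifs <;> simp

variable [DecidableEq V]

theorem SubEigen.sum_adj_le_sub [Fintype V] [DecidableRel G.Adj] {l : ℝ} {y : V → ℝ} {u : V}
    (hy : SubEigen G l y u) (A : Finset V) {v : V} (hv : v ∈ A) :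
    (∑ w ∈ A, if G.Adj v w then y w else 0) ≤ ∑ w ∈ A, y w - y v := by
  rw [← Finset.add_sum_erase _ _ hv, ← Finset.add_sum_erase _ y hv, if_neg G.irrefl]
  linarith [hy.sum_adj_le (A.erase v) v]

theorem edges_subset_of_length_eq (hG : ¬ HasTwoCyclesSameLength G) {u v : V}
    {c₁ : G.Walk u u} {c₂ : G.Walk v v} (h₁ : c₁.IsCycle) (h₂ : c₂.IsCycle)
    (h : c₁.length = c₂.length) {e : Sym2 V} (he : e ∈ c₁.edges) : e ∈ c₂.edges := by
  by_contra hne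
  exact hG ⟨u, v, c₁, c₂, h₁, h₂, h, fun heq => hne (by
    rw [← List.mem_toFinset, ← heq]; exact List.mem_toFinset.2 he)⟩

theorem sum_fst_le_sum_add (E : Finset (V × V)) (W : Finset V) (f : V → V) (y : V → ℝ)
    (hy : ∀ v, 0 ≤ y v) (hE : ∀ q ∈ E, q.1 ∈ W) :
    ∑ q ∈ E, y q.1 ≤ ∑ w ∈ W, y w + ∑ q ∈ E.filter (fun q => q.2 ≠ f q.1), y q.1 := by
  rw [← Finset.sum_filter_add_sum_filter_not E (fun q => q.2 = f q.1)]
  gcongr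
  rw [← Finset.sum_image (f := y) (g := Prod.fst) (s := E.filter (fun q => q.2 = f q.1))]
  · refine Finset.sum_le_sum_of_subset_of_nonneg ?_ (fun _ _ _ => hy _)
    intro w hw
    simp only [Finset.mem_image, Finset.mem_filter] at hw
    obtain ⟨q, hq, rfl⟩ := hw
    exact hE q hq.1
  · intro q hq q' hq' h
    simp only [Finset.coe_filter, Set.mem_ofPred_eq] at hq hq'
    exact Prod.ext h (by rw [hq.2, hq'.2, h])

theorem card_le_card_add (E : Finset (V × V)) (W : Finset V) (f : V → V)
    (hE : ∀ q ∈ E, q.1 ∈ W) :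
    E.card ≤ W.card + (E.filter (fun q => q.2 ≠ f q.1)).card := by
  have := sum_fst_le_sum_add E W f (fun _ => 1) (fun _ => zero_le_one) hE
  simp only [Finset.sum_const, nsmul_eq_mul, mul_one] at this
  exact_mod_cast this

theorem card_le_two_of_sym2_eq (E : Finset (V × V))
    (h : ∀ q ∈ E, ∀ q' ∈ E, s(q.1, q.2) = s(q'.1, q'.2)) : E.card ≤ 2 := by
  rcases E.eq_empty_or_nonempty with rfl | ⟨q, hq⟩
  · simp
  · refine (Finset.card_le_card (t := {q, q.swap}) ?_).trans Finset.card_le_two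
    intro q' hq'
    have := h q' hq' q hq
    rw [Sym2.eq_iff] at this
    simp only [Finset.mem_insert, Finset.mem_singleton, Prod.ext_iff, Prod.fst_swap, Prod.snd_swap]
    exact this

namespace Layers

variable {u : V} {N W₂ W₃ : Finset V} {p : V → V}

theorem sym2_eq_of_mem_N (hG : ¬ HasTwoCyclesSameLength G) [DecidableRel G.Adj]
    (L : Layers G u N W₂ W₃ p) :
    ∀ q ∈ G.adjPairs N N, ∀ q' ∈ G.adjPairs N N, s(q.1, q.2) = s(q'.1, q'.2) := by
  rintro ⟨a, b⟩ hq ⟨a', b'⟩ hq'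
  simp only [mem_adjPairs, L.mem_N] at hq hq'
  obtain ⟨c₁, h₁, l₁, e₁⟩ := exists_cycle_three hq.1.1 hq.2 hq.1.2.symm
  obtain ⟨c₂, h₂, l₂, e₂⟩ := exists_cycle_three hq'.1.1 hq'.2 hq'.1.2.symm
  have := edges_subset_of_length_eq hG h₁ h₂ (l₁.trans l₂.symm) (e := s(a, b)) (by simp [e₁])
  simp only [e₂, List.mem_cons, List.not_mem_nil, or_false, Sym2.eq_iff] at this
  have h1 := hq.1.1.ne
  have h2 := hq.1.2.ne
  simp only [Sym2.eq_iff]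
  grind

theorem eq_of_mem_W₂_N (hG : ¬ HasTwoCyclesSameLength G) [DecidableRel G.Adj]
    (L : Layers G u N W₂ W₃ p) :
    ∀ q ∈ (G.adjPairs W₂ N).filter (fun q => q.2 ≠ p q.1),
      ∀ q' ∈ (G.adjPairs W₂ N).filter (fun q => q.2 ≠ p q.1), q = q' := by
  rintro ⟨w, v⟩ hq ⟨w', v'⟩ hq'
  simp only [Finset.mem_filter, mem_adjPairs, L.mem_N] at hq hq'
  obtain ⟨⟨⟨hw, huv⟩, hwv⟩, hvp⟩ := hq
  obtain ⟨⟨⟨hw', huv'⟩, hwv'⟩, hvp'⟩ := hq'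
  obtain ⟨n1, n2, n3, n4⟩ := L.mem_W₂ w hw
  obtain ⟨m1, m2, m3, m4⟩ := L.mem_W₂ w' hw'
  obtain ⟨c₁, h₁, l₁, e₁⟩ := exists_cycle_four n3 n4.symm hwv huv.symm n1.symm (Ne.symm hvp)
  obtain ⟨c₂, h₂, l₂, e₂⟩ := exists_cycle_four m3 m4.symm hwv' huv'.symm m1.symm (Ne.symm hvp')
  have := edges_subset_of_length_eq hG h₁ h₂ (l₁.trans l₂.symm) (e := s(w, v)) (by simp [e₁])
  simp only [e₂, List.mem_cons, List.not_mem_nil, or_false, Sym2.eq_iff] at this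
  grind

theorem card_adjPairs_W₂_W₂ (hG : ¬ HasTwoCyclesSameLength G) [DecidableRel G.Adj]
    (L : Layers G u N W₂ W₃ p) : (G.adjPairs W₂ W₂).card ≤ 4 := by
  rw [← Finset.card_filter_add_card_filter_not (fun q : V × V => p q.1 = p q.2)]
  refine add_le_add (b := 2) (d := 2) (card_le_two_of_sym2_eq _ ?_) (card_le_two_of_sym2_eq _ ?_)
  all_goals
    rintro ⟨w, x⟩ hq ⟨w', x'⟩ hq'
    simp only [Finset.mem_filter, mem_adjPairs] at hq hq'
    obtain ⟨⟨⟨hw, hx⟩, hwx⟩, hp⟩ := hq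
    obtain ⟨⟨⟨hw', hx'⟩, hwx'⟩, hp'⟩ := hq'
    obtain ⟨n1, n2, n3, n4⟩ := L.mem_W₂ w hw
    obtain ⟨m1, m2, m3, m4⟩ := L.mem_W₂ w' hw'
    obtain ⟨i1, i2, i3, i4⟩ := L.mem_W₂ x hx
    obtain ⟨j1, j2, j3, j4⟩ := L.mem_W₂ x' hx'
  · rw [← hp] at i3 i4
    rw [← hp'] at j3 j4
    obtain ⟨c₁, h₁, l₁, e₁⟩ := exists_cycle_three n4.symm hwx i4
    obtain ⟨c₂, h₂, l₂, e₂⟩ := exists_cycle_three m4.symm hwx' j4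
    have := edges_subset_of_length_eq hG h₁ h₂ (l₁.trans l₂.symm) (e := s(w, x)) (by simp [e₁])
    simp only [e₂, List.mem_cons, List.not_mem_nil, or_false, Sym2.eq_iff] at this
    simp only [Sym2.eq_iff]
    grind
  · obtain ⟨c₁, h₁, l₁, e₁⟩ := exists_cycle_five n3 n4.symm hwx i4 i3.symm
      (by simp; grind [G.irrefl])
    obtain ⟨c₂, h₂, l₂, e₂⟩ := exists_cycle_five m3 m4.symm hwx' j4 j3.symm
      (by simp; grind [G.irrefl])
    have := edges_subset_of_length_eq hG h₁ h₂ (l₁.trans l₂.symm) (e := s(w, x)) (by simp [e₁])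
    simp only [e₂, List.mem_cons, List.not_mem_nil, or_false, Sym2.eq_iff] at this
    simp only [Sym2.eq_iff]
    grind

theorem card_adjPairs_W₃_W₂ (hG : ¬ HasTwoCyclesSameLength G) [DecidableRel G.Adj]
    (L : Layers G u N W₂ W₃ p) : (G.adjPairs W₃ W₂).card ≤ W₃.card + 2 := by
  have hf : ∀ z, ∃ w, (∃ x ∈ W₂, G.Adj z x) → w ∈ W₂ ∧ G.Adj z w := by
    intro z
    by_cases h : ∃ x ∈ W₂, G.Adj z x
    · obtain ⟨x, hx⟩ := h
      exact ⟨x, fun _ => hx⟩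
    · exact ⟨z, fun h' => absurd h' h⟩
  choose f hf using hf
  refine (card_le_card_add _ W₃ f fun q hq => (mem_adjPairs.1 hq).1.1).trans ?_
  gcongr
  rw [← Finset.card_filter_add_card_filter_not (fun q : V × V => p q.2 = p (f q.1))]
  refine add_le_add (b := 1) (d := 1) (Finset.card_le_one.2 ?_) (Finset.card_le_one.2 ?_)
  all_goals
    rintro ⟨z, w⟩ hq ⟨z', w'⟩ hq'
    simp only [Finset.mem_filter, mem_adjPairs] at hq hq'
    obtain ⟨⟨⟨⟨hz, hw⟩, hzw⟩, hne⟩, hp⟩ := hq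
    obtain ⟨⟨⟨⟨hz', hw'⟩, hzw'⟩, hne'⟩, hp'⟩ := hq'
    obtain ⟨hfz, hzf⟩ := hf z ⟨w, hw, hzw⟩
    obtain ⟨hfz', hzf'⟩ := hf z' ⟨w', hw', hzw'⟩
    obtain ⟨n1, n2, n3, n4⟩ := L.mem_W₂ w hw
    obtain ⟨m1, m2, m3, m4⟩ := L.mem_W₂ w' hw'
    obtain ⟨i1, i2, i3, i4⟩ := L.mem_W₂ _ hfz
    obtain ⟨j1, j2, j3, j4⟩ := L.mem_W₂ _ hfz'
    obtain ⟨k1, k2, k3⟩ := L.mem_W₃ z hz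
    obtain ⟨l1, l2, l3⟩ := L.mem_W₃ z' hz'
  · rw [← hp] at i3 i4
    rw [← hp'] at j3 j4
    obtain ⟨c₁, h₁, l₁, e₁⟩ := exists_cycle_four n4.symm hzw.symm hzf i4 (by grind) hne
    obtain ⟨c₂, h₂, l₂, e₂⟩ := exists_cycle_four m4.symm hzw'.symm hzf' j4 (by grind) hne'
    have := edges_subset_of_length_eq hG h₁ h₂ (l₁.trans l₂.symm) (e := s(w, z)) (by simp [e₁])
    simp only [e₂, List.mem_cons, List.not_mem_nil, or_false, Sym2.eq_iff] at this
    grind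
  · obtain ⟨c₁, h₁, l₁, e₁⟩ := exists_cycle_six n3 n4.symm hzw.symm hzf i4 i3.symm
      (by simp; grind [G.irrefl])
    obtain ⟨c₂, h₂, l₂, e₂⟩ := exists_cycle_six m3 m4.symm hzw'.symm hzf' j4 j3.symm
      (by simp; grind [G.irrefl])
    have := edges_subset_of_length_eq hG h₁ h₂ (l₁.trans l₂.symm) (e := s(w, z)) (by simp [e₁])
    simp only [e₂, List.mem_cons, List.not_mem_nil, or_false, Sym2.eq_iff] at this
    grind

theorem card_adjPairs_W₂_N (hG : ¬ HasTwoCyclesSameLength G) [DecidableRel G.Adj]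
    (L : Layers G u N W₂ W₃ p) : (G.adjPairs W₂ N).card ≤ W₂.card + 1 := by
  refine (card_le_card_add _ W₂ p fun q hq => (mem_adjPairs.1 hq).1.1).trans ?_
  gcongr
  exact Finset.card_le_one.2 (L.eq_of_mem_W₂_N hG)

theorem disjoint_N (L : Layers G u N W₂ W₃ p) : Disjoint N (W₂ ∪ W₃) := by
  rw [Finset.disjoint_left]
  intro w h1 h2
  rw [L.mem_N] at h1
  rcases Finset.mem_union.1 h2 with h | h
  · exact (L.mem_W₂ w h).2.1 h1
  · exact (L.mem_W₃ w h).2.1 h1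

theorem sum_eq [Fintype V] (L : Layers G u N W₂ W₃ p)
    (hcov : ∀ v, v = u ∨ v ∈ N ∨ v ∈ W₂ ∨ v ∈ W₃) (f : V → ℝ) :
    ∑ v, f v = f u + (∑ v ∈ N, f v + (∑ v ∈ W₂, f v + ∑ v ∈ W₃, f v)) := by
  have hu : u ∉ N ∪ (W₂ ∪ W₃) := by
    intro h
    simp only [Finset.mem_union, L.mem_N] at h
    rcases h with h | h | h
    · exact G.irrefl h
    · exact (L.mem_W₂ u h).1 rfl
    · exact (L.mem_W₃ u h).1 rfl
  rw [← Finset.sum_union L.disjoint_W₂_W₃, ← Finset.sum_union L.disjoint_N,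
    ← Finset.sum_insert hu]
  congr 1
  ext v
  simpa using hcov v

theorem card_eq [Fintype V] (L : Layers G u N W₂ W₃ p)
    (hcov : ∀ v, v = u ∨ v ∈ N ∨ v ∈ W₂ ∨ v ∈ W₃) :
    (Fintype.card V : ℝ) = 1 + (N.card + (W₂.card + W₃.card)) := by
  have := L.sum_eq hcov (fun _ => 1)
  simpa using this

variable [Fintype V] [DecidableRel G.Adj] {l : ℝ} {y : V → ℝ}

theorem sum_W₂_N_le (hG : ¬ HasTwoCyclesSameLength G) (L : Layers G u N W₂ W₃ p)
    (hy : SubEigen G l y u) :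
    ∑ q ∈ G.adjPairs W₂ N, y q.1 ≤ ∑ w ∈ W₂, y w + min 1 (∑ w ∈ W₂, y w) := by
  refine (sum_fst_le_sum_add _ W₂ p y hy.nonneg fun q hq => (mem_adjPairs.1 hq).1.1).trans ?_
  gcongr
  have hT : 0 ≤ ∑ w ∈ W₂, y w := Finset.sum_nonneg fun w _ => hy.nonneg w
  rcases Finset.eq_empty_or_nonempty ((G.adjPairs W₂ N).filter fun q => q.2 ≠ p q.1) with h | ⟨q, hq⟩
  · rw [h, Finset.sum_empty]
    exact le_min zero_le_one hT
  · rw [Finset.eq_singleton_iff_unique_mem.2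
      ⟨hq, fun q' hq' => L.eq_of_mem_W₂_N hG q' hq' q hq⟩, Finset.sum_singleton]
    exact le_min (hy.le_one _) (Finset.single_le_sum (f := y) (fun w _ => hy.nonneg w)
      (mem_adjPairs.1 (Finset.mem_filter.1 hq).1).1.1)

theorem mul_le_of_mem_N (L : Layers G u N W₂ W₃ p)
    (hcov : ∀ v, v = u ∨ v ∈ N ∨ v ∈ W₂ ∨ v ∈ W₃) (hy : SubEigen G l y u) {v : V}
    (hv : v ∈ N) :
    l * y v ≤ 1 + ((∑ w ∈ N, if G.Adj v w then y w else 0) +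
      ∑ w ∈ W₂, if G.Adj v w then y w else 0) := by
  have h := hy.mul_le v
  rw [L.sum_eq hcov] at h
  have huv := (L.mem_N v).1 hv
  have h3 : (∑ w ∈ W₃, if G.Adj v w then y w else 0) = 0 :=
    Finset.sum_eq_zero fun z hz => if_neg fun ha => (L.mem_W₃ z hz).2.2 v huv ha.symm
  rw [h3, if_pos huv.symm, hy.eq_one, add_zero] at h
  exact h

theorem mul_le_of_mem_W₂ (L : Layers G u N W₂ W₃ p)
    (hcov : ∀ v, v = u ∨ v ∈ N ∨ v ∈ W₂ ∨ v ∈ W₃) (hy : SubEigen G l y u) {v : V}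
    (hv : v ∈ W₂) :
    l * y v ≤ (∑ w ∈ N, if G.Adj v w then y w else 0) +
      ((∑ w ∈ W₂, if G.Adj v w then y w else 0) + ∑ w ∈ W₃, if G.Adj v w then y w else 0) := by
  have h := hy.mul_le v
  rwa [L.sum_eq hcov, if_neg fun ha => (L.mem_W₂ v hv).2.1 ha.symm, zero_add] at h

theorem mul_le_of_mem_W₃ (L : Layers G u N W₂ W₃ p)
    (hcov : ∀ v, v = u ∨ v ∈ N ∨ v ∈ W₂ ∨ v ∈ W₃) (hy : SubEigen G l y u) {v : V}
    (hv : v ∈ W₃) :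
    l * y v ≤ (∑ w ∈ W₂, if G.Adj v w then y w else 0) +
      ∑ w ∈ W₃, if G.Adj v w then y w else 0 := by
  have h := hy.mul_le v
  rwa [L.sum_eq hcov, if_neg fun ha => (L.mem_W₃ v hv).2.1 ha.symm, zero_add,
    Finset.sum_eq_zero (s := N) fun w hw => if_neg ((L.mem_W₃ v hv).2.2 w ((L.mem_N w).1 hw)),
    zero_add] at h

theorem sq_le (L : Layers G u N W₂ W₃ p)
    (hcov : ∀ v, v = u ∨ v ∈ N ∨ v ∈ W₂ ∨ v ∈ W₃) (hy : SubEigen G l y u) (hl : 0 ≤ l) :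
    l ^ 2 ≤ N.card + ∑ q ∈ G.adjPairs N N, y q.2 + ∑ q ∈ G.adjPairs W₂ N, y q.1 := by
  have h := hy.mul_le u
  rw [L.sum_eq hcov, if_neg (G.irrefl), hy.eq_one, mul_one, zero_add,
    Finset.sum_eq_zero (s := W₂) fun w hw => if_neg (L.mem_W₂ w hw).2.1,
    Finset.sum_eq_zero (s := W₃) fun w hw => if_neg (L.mem_W₃ w hw).2.1, add_zero, add_zero,
    Finset.sum_congr rfl fun v hv => if_pos ((L.mem_N v).1 hv)] at h
  calc l ^ 2 = l * l := sq l
    _ ≤ l * ∑ v ∈ N, y v := by gcongr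
    _ = ∑ v ∈ N, l * y v := Finset.mul_sum ..
    _ ≤ ∑ v ∈ N, (1 + ((∑ w ∈ N, if G.Adj v w then y w else 0) +
          ∑ w ∈ W₂, if G.Adj v w then y w else 0)) :=
        Finset.sum_le_sum fun v hv => L.mul_le_of_mem_N hcov hy hv
    _ = _ := by
        rw [sum_adjPairs_swap W₂ N, sum_adjPairs, sum_adjPairs]
        simp [Finset.sum_add_distrib, add_assoc]

theorem sum_adj_N_le (hG : ¬ HasTwoCyclesSameLength G) (L : Layers G u N W₂ W₃ p)
    (hy : SubEigen G l y u) {v : V} (hv : v ∈ N) :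
    (∑ w ∈ N, if G.Adj v w then y w else 0) ≤ 1 := by
  rw [← Finset.sum_filter]
  have hc : (N.filter fun w => G.Adj v w).card ≤ 1 := by
    refine Finset.card_le_one.2 fun a ha b hb => ?_
    simp only [Finset.mem_filter] at ha hb
    have := L.sym2_eq_of_mem_N hG (v, a) (mem_adjPairs.2 ⟨⟨hv, ha.1⟩, ha.2⟩)
      (v, b) (mem_adjPairs.2 ⟨⟨hv, hb.1⟩, hb.2⟩)
    simp only [Sym2.eq_iff] at this
    grind
  calc _ ≤ ∑ w ∈ N.filter fun w => G.Adj v w, (1 : ℝ) := Finset.sum_le_sum fun w _ => hy.le_one w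
    _ = ((N.filter fun w => G.Adj v w).card : ℝ) := by simp
    _ ≤ 1 := by exact_mod_cast hc

theorem sum_N_N_le (hG : ¬ HasTwoCyclesSameLength G) (L : Layers G u N W₂ W₃ p)
    (hcov : ∀ v, v = u ∨ v ∈ N ∨ v ∈ W₂ ∨ v ∈ W₃) (hy : SubEigen G l y u) {a b : V}
    (ha : a ∈ N) (hb : b ∈ N) (hab : G.Adj a b) :
    (l - 1) * ∑ q ∈ G.adjPairs N N, y q.2 ≤ 2 + ∑ q ∈ G.adjPairs W₂ N, y q.1 := by
  have key := L.sym2_eq_of_mem_N hG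
  have hE : G.adjPairs N N = {(a, b), (b, a)} := by
    ext ⟨c, d⟩
    constructor
    · intro h
      have := key _ h (a, b) (mem_adjPairs.2 ⟨⟨ha, hb⟩, hab⟩)
      simpa using this
    · intro h
      simp only [Finset.mem_insert, Finset.mem_singleton, Prod.mk.injEq] at h
      rcases h with ⟨rfl, rfl⟩ | ⟨rfl, rfl⟩
      · exact mem_adjPairs.2 ⟨⟨ha, hb⟩, hab⟩
      · exact mem_adjPairs.2 ⟨⟨hb, ha⟩, hab.symm⟩
  have hQ : ∑ q ∈ G.adjPairs N N, y q.2 = y a + y b := by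
    rw [hE, Finset.sum_pair (by simp [hab.ne])]
    exact add_comm _ _
  have hE' : ∑ v ∈ N, (∑ w ∈ N, if G.Adj v w then y w else 0) = y a + y b := by
    rw [← hQ, sum_adjPairs]
  have hS : (∑ w ∈ W₂, if G.Adj a w then y w else 0) + (∑ w ∈ W₂, if G.Adj b w then y w else 0)
      ≤ ∑ q ∈ G.adjPairs W₂ N, y q.1 := by
    rw [sum_adjPairs_swap W₂ N, sum_adjPairs,
      ← Finset.sum_pair (f := fun v => ∑ w ∈ W₂, if G.Adj v w then y w else 0) hab.ne]
    refine Finset.sum_le_sum_of_subset_of_nonneg ?_ fun v _ _ => Finset.sum_nonneg fun w _ => ?_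
    · intro x hx
      simp only [Finset.mem_insert, Finset.mem_singleton] at hx
      rcases hx with rfl | rfl <;> assumption
    · split_ifs
      · exact hy.nonneg w
      · exact le_rfl
  have h2 : (∑ w ∈ N, if G.Adj a w then y w else 0) + (∑ w ∈ N, if G.Adj b w then y w else 0)
      ≤ y a + y b := by
    rw [← hE',
      ← Finset.sum_pair (f := fun v => ∑ w ∈ N, if G.Adj v w then y w else 0) hab.ne]
    refine Finset.sum_le_sum_of_subset_of_nonneg ?_ fun v _ _ => Finset.sum_nonneg fun w _ => ?_
    · intro x hx
      simp only [Finset.mem_insert, Finset.mem_singleton] at hx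
      rcases hx with rfl | rfl <;> assumption
    · split_ifs
      · exact hy.nonneg w
      · exact le_rfl
  rw [hQ]
  linarith [L.mul_le_of_mem_N hcov hy ha, L.mul_le_of_mem_N hcov hy hb]

theorem mul_sum_W₂_le (hG : ¬ HasTwoCyclesSameLength G) (L : Layers G u N W₂ W₃ p)
    (hcov : ∀ v, v = u ∨ v ∈ N ∨ v ∈ W₂ ∨ v ∈ W₃) (hy : SubEigen G l y u) :
    l * ∑ w ∈ W₂, y w ≤ W₂.card + W₃.card + 7 := by
  have hone : ∀ A B : Finset V, ∑ q ∈ G.adjPairs A B, y q.2 ≤ ((G.adjPairs A B).card : ℝ) := by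
    intro A B
    calc _ ≤ ∑ q ∈ G.adjPairs A B, (1 : ℝ) := Finset.sum_le_sum fun q _ => hy.le_one _
      _ = _ := by simp
  have h3 : (G.adjPairs W₂ W₃).card = (G.adjPairs W₃ W₂).card := by
    have := sum_adjPairs_swap (G := G) W₂ W₃ (fun _ => 1)
    simpa using this
  have c1 : ((G.adjPairs W₂ N).card : ℝ) ≤ W₂.card + 1 := mod_cast L.card_adjPairs_W₂_N hG
  have c2 : ((G.adjPairs W₂ W₂).card : ℝ) ≤ 4 := mod_cast L.card_adjPairs_W₂_W₂ hG
  have c3 : ((G.adjPairs W₂ W₃).card : ℝ) ≤ W₃.card + 2 := by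
    rw [h3]; exact_mod_cast L.card_adjPairs_W₃_W₂ hG
  have h1 : l * ∑ w ∈ W₂, y w ≤ ∑ q ∈ G.adjPairs W₂ N, y q.2 +
      (∑ q ∈ G.adjPairs W₂ W₂, y q.2 + ∑ q ∈ G.adjPairs W₂ W₃, y q.2) := by
    rw [Finset.mul_sum, sum_adjPairs, sum_adjPairs, sum_adjPairs, ← Finset.sum_add_distrib,
      ← Finset.sum_add_distrib]
    exact Finset.sum_le_sum fun w hw => L.mul_le_of_mem_W₂ hcov hy hw
  linarith [hone W₂ N, hone W₂ W₂, hone W₂ W₃]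

theorem mul_mul_sum_le (hG : ¬ HasTwoCyclesSameLength G) (L : Layers G u N W₂ W₃ p)
    (hcov : ∀ v, v = u ∨ v ∈ N ∨ v ∈ W₂ ∨ v ∈ W₃) (hy : SubEigen G l y u) (hl : 0 ≤ l) {t k : ℝ}
    (ht : t = ∑ w ∈ W₂, y w + ∑ w ∈ W₃, y w) (hk : k = W₂.card + W₃.card) :
    l * ((l - k + 1) * t) ≤ (k + 1) * (2 + t) := by
  have ht3 : 0 ≤ ∑ w ∈ W₃, y w := Finset.sum_nonneg fun w _ => hy.nonneg w
  have ht2 : 0 ≤ ∑ w ∈ W₂, y w := Finset.sum_nonneg fun w _ => hy.nonneg w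
  have hα : ∀ v ∈ N, l * y v ≤ 2 + t := by
    intro v hv
    have := L.mul_le_of_mem_N hcov hy hv
    linarith [L.sum_adj_N_le hG hy hv, hy.sum_adj_le W₂ v]
  have hB : l * ∑ q ∈ G.adjPairs W₂ N, y q.2 ≤ (k + 1) * (2 + t) := by
    have hc : ((G.adjPairs W₂ N).card : ℝ) ≤ W₂.card + 1 := mod_cast L.card_adjPairs_W₂_N hG
    have hW3 : (0 : ℝ) ≤ W₃.card := Nat.cast_nonneg _
    calc _ = ∑ q ∈ G.adjPairs W₂ N, l * y q.2 := Finset.mul_sum ..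
      _ ≤ ∑ q ∈ G.adjPairs W₂ N, (2 + t) :=
          Finset.sum_le_sum fun q hq => hα _ (mem_adjPairs.1 hq).1.2
      _ = ((G.adjPairs W₂ N).card : ℝ) * (2 + t) := by rw [Finset.sum_const, nsmul_eq_mul]
      _ ≤ _ := by gcongr <;> linarith
  have h2 : l * ∑ w ∈ W₂, y w ≤ ∑ q ∈ G.adjPairs W₂ N, y q.2 + ∑ w ∈ W₂, (t - y w) := by
    rw [Finset.mul_sum, sum_adjPairs, ← Finset.sum_add_distrib]
    refine Finset.sum_le_sum fun w hw => (L.mul_le_of_mem_W₂ hcov hy hw).trans ?_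
    linarith [hy.sum_adj_le_sub W₂ hw, hy.sum_adj_le W₃ w]
  have h3 : l * ∑ w ∈ W₃, y w ≤ ∑ w ∈ W₃, (t - y w) := by
    rw [Finset.mul_sum]
    refine Finset.sum_le_sum fun w hw => (L.mul_le_of_mem_W₃ hcov hy hw).trans ?_
    linarith [hy.sum_adj_le_sub W₃ hw, hy.sum_adj_le W₂ w]
  simp only [Finset.sum_sub_distrib, Finset.sum_const, nsmul_eq_mul] at h2 h3
  have h4 : (l - k + 1) * t ≤ ∑ q ∈ G.adjPairs W₂ N, y q.2 := by
    have e : l * t = l * ∑ w ∈ W₂, y w + l * ∑ w ∈ W₃, y w := by rw [ht]; ring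
    have e2 : k * t = W₂.card * t + W₃.card * t := by rw [hk]; ring
    linarith
  exact (mul_le_mul_of_nonneg_left h4 hl).trans hB

end Layers

theorem exists_triangle_of_subEigen [Fintype V] [DecidableRel G.Adj]
    (hG : ¬ HasTwoCyclesSameLength G) {l : ℝ} {y : V → ℝ} {u : V} (hy : SubEigen G l y u)
    (hl : 5 < l) (hn : 2 ≤ (l ^ 2 - (Fintype.card V - 1)) * (l - 1)) :
    ∃ a b, G.Adj u a ∧ G.Adj u b ∧ G.Adj a b ∧ ∀ v, v ≠ u → G.Adj u v := by
  have hp : ∀ w, ∃ v, (∃ x, G.Adj u x ∧ G.Adj w x) → G.Adj u v ∧ G.Adj w v := by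
    intro w
    by_cases h : ∃ x, G.Adj u x ∧ G.Adj w x
    · obtain ⟨x, hx⟩ := h
      exact ⟨x, fun _ => hx⟩
    · exact ⟨w, fun h' => absurd h' h⟩
  choose p hp using hp
  obtain ⟨N, hN⟩ : ∃ N : Finset V, ∀ v, v ∈ N ↔ G.Adj u v :=
    ⟨Finset.univ.filter (G.Adj u), by simp⟩
  obtain ⟨W₂, hW₂⟩ : ∃ W : Finset V, ∀ w, w ∈ W ↔
      w ≠ u ∧ ¬ G.Adj u w ∧ ∃ x, G.Adj u x ∧ G.Adj w x := by
    classical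
    exact ⟨Finset.univ.filter fun w => w ≠ u ∧ ¬ G.Adj u w ∧ ∃ x, G.Adj u x ∧ G.Adj w x, by simp⟩
  obtain ⟨W₃, hW₃⟩ : ∃ W : Finset V, ∀ w, w ∈ W ↔
      w ≠ u ∧ ¬ G.Adj u w ∧ ¬ ∃ x, G.Adj u x ∧ G.Adj w x := by
    classical
    exact ⟨Finset.univ.filter fun w => w ≠ u ∧ ¬ G.Adj u w ∧ ¬ ∃ x, G.Adj u x ∧ G.Adj w x, by simp⟩
  have L : Layers G u N W₂ W₃ p := by
    refine ⟨hN, fun w hw => ?_, fun w hw => ?_⟩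
    · obtain ⟨h1, h2, h3⟩ := (hW₂ w).1 hw
      exact ⟨h1, h2, hp w h3⟩
    · obtain ⟨h1, h2, h3⟩ := (hW₃ w).1 hw
      exact ⟨h1, h2, fun v hv hv' => h3 ⟨v, hv, hv'⟩⟩
  have hcov : ∀ v, v = u ∨ v ∈ N ∨ v ∈ W₂ ∨ v ∈ W₃ := by
    intro v
    rw [hN, hW₂, hW₃]
    grind
  have hcard := L.card_eq hcov
  have hsq := L.sq_le hcov hy (by linarith)
  have hS := L.sum_W₂_N_le hG hy
  have hT := L.mul_sum_W₂_le hG hcov hy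
  have hT' := L.mul_mul_sum_le hG hcov hy (by linarith) rfl rfl
  have ht3 : 0 ≤ ∑ w ∈ W₃, y w := Finset.sum_nonneg fun w _ => hy.nonneg w
  have ht2 : 0 ≤ ∑ w ∈ W₂, y w := Finset.sum_nonneg fun w _ => hy.nonneg w
  have hS0 : 0 ≤ ∑ q ∈ G.adjPairs W₂ N, y q.1 := Finset.sum_nonneg fun w _ => hy.nonneg _
  have hQ : (l - 1) * ∑ q ∈ G.adjPairs N N, y q.2 ≤ 2 + ∑ q ∈ G.adjPairs W₂ N, y q.1 := by
    rcases (G.adjPairs N N).eq_empty_or_nonempty with h | ⟨⟨a, b⟩, h⟩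
    · rw [h, Finset.sum_empty]
      linarith
    · obtain ⟨⟨ha, hb⟩, hab⟩ := mem_adjPairs.1 h
      exact L.sum_N_N_le hG hcov hy ha hb hab
  obtain ⟨k, hk⟩ : ∃ k, k = W₂.card + W₃.card := ⟨_, rfl⟩
  have hkr : (k : ℝ) = W₂.card + W₃.card := mod_cast hk
  rw [← hkr] at hcard hT hT'
  generalize hSd : ∑ q ∈ G.adjPairs W₂ N, y q.1 = S at *
  generalize hQd : ∑ q ∈ G.adjPairs N N, y q.2 = Q at *
  generalize ∑ w ∈ W₂, y w = T at *
  generalize ∑ w ∈ W₃, y w = T₃ at *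
  have hmain : k * (l - 1) ≤ l * S := by
    rw [hcard] at hn
    nlinarith
  have hS1 : S ≤ T + 1 := hS.trans (by gcongr; exact min_le_left _ _)
  have hS2 : S ≤ T + T := hS.trans (by gcongr; exact min_le_right _ _)
  have hk0 : k = 0 := by
    by_contra hk0
    have hk4 : k ≤ 4 := by
      by_contra h5
      have h5 : (5 : ℝ) ≤ k := by exact_mod_cast (by omega : 5 ≤ k)
      nlinarith
    have hS3 : 4 * (k : ℝ) ≤ 5 * S := by nlinarith
    obtain ⟨t, rfl⟩ : ∃ t, T = t - T₃ := ⟨T + T₃, by ring⟩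
    rw [sub_add_cancel] at hT'
    have hmono : 5 * ((6 - k) * t) ≤ l * ((l - k + 1) * t) := by
      have hk4' : (k : ℝ) ≤ 4 := by exact_mod_cast hk4
      have h0 : 0 ≤ t := by linarith
      have h6 : 0 ≤ (6 - (k : ℝ)) * t := mul_nonneg (by linarith) h0
      gcongr
      linarith
    interval_cases k <;> norm_num at * <;> linarith
  have hW2 : W₂ = ∅ := Finset.card_eq_zero.1 (by omega)
  have hW3 : W₃ = ∅ := Finset.card_eq_zero.1 (by omega)
  have hall : ∀ v, v ≠ u → G.Adj u v := by
    intro v hv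
    have := hcov v
    simp only [hW2, hW3, Finset.notMem_empty, or_false] at this
    exact (hN v).1 (this.resolve_left hv)
  rcases (G.adjPairs N N).eq_empty_or_nonempty with h | ⟨⟨a, b⟩, h⟩
  · exfalso
    have hQ0 : Q = 0 := by rw [← hQd, h, Finset.sum_empty]
    have hS0 : S = 0 := by rw [← hSd, hW2]; simp [adjPairs]
    rw [hcard, hk0] at hn
    push_cast at hn
    nlinarith
  · obtain ⟨⟨ha, hb⟩, hab⟩ := mem_adjPairs.1 h
    exact ⟨a, b, (hN a).1 ha, (hN b).1 hb, hab, hall⟩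

end SimpleGraph

theorem finite_setOf_mulVec_eq_smul {V : Type*} [Fintype V] (A : Matrix V V ℝ) :
    {t : ℝ | ∃ x : V → ℝ, x ≠ 0 ∧ A.mulVec x = t • x}.Finite := by
  classical
  refine (Module.End.finite_hasEigenvalue (Matrix.toLin' A)).subset ?_
  rintro t ⟨x, hx, h⟩
  exact Module.End.hasEigenvalue_of_hasEigenvector
    ⟨Module.End.mem_eigenspace_iff.2 (by rwa [Matrix.toLin'_apply]), hx⟩

theorem starPlus_adj {n : ℕ} {i j : Fin n} : (starPlus n).Adj i j ↔
    i.val ≠ j.val ∧ ((i.val = 0 ∨ i.val < 3 ∧ j.val < 3) ∨ (j.val = 0 ∨ j.val < 3 ∧ i.val < 3)) := by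
  rw [starPlus, SimpleGraph.fromRel_adj, ne_eq, Fin.ext_iff]

theorem starPlus_adjMat_mulVec {m : ℕ} {r : ℝ} (hr : 1 < r)
    (h : r ^ 3 - r ^ 2 - (m + 2) * r + m = 0) :
    (adjMat (starPlus (m + 3))).mulVec
      (Fin.cons (r - 1) (Fin.cons 1 (Fin.cons 1 fun _ : Fin m => (r - 1) / r))) =
    r • (Fin.cons (r - 1) (Fin.cons 1 (Fin.cons 1 fun _ : Fin m => (r - 1) / r)) :
      Fin (m + 3) → ℝ) := by
  have hr0 : r ≠ 0 := by linarith
  have h3 (a : ℕ) : ¬ a + 1 + 1 + 1 < 3 := by omega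
  ext i
  refine Fin.cases ?_ (fun i => Fin.cases ?_ (fun i => Fin.cases ?_ (fun i => ?_) i) i) i
  all_goals
    simp only [adjMat, Matrix.mulVec, dotProduct, Fin.sum_univ_succ, starPlus_adj, Matrix.of_apply,
      Fin.cons_zero, Fin.cons_succ, Fin.val_zero, Fin.val_succ, Pi.smul_apply, smul_eq_mul]
    simp [h3]
  · field_simp
    linarith
  · field_simp

theorem exists_le_specRad_starPlus {n : ℕ} (hn : 26 ≤ n) :
    ∃ r : ℝ, 5 < r ∧ 2 ≤ (r ^ 2 - (n - 1)) * (r - 1) ∧ r ≤ specRad (starPlus n) := by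
  obtain ⟨m, rfl⟩ : ∃ m, n = m + 3 := ⟨n - 3, by omega⟩
  have hm : (23 : ℝ) ≤ m := by exact_mod_cast (by omega : 23 ≤ m)
  have hcont : Continuous fun r : ℝ => r ^ 3 - r ^ 2 - (m + 2) * r + m := by fun_prop
  obtain ⟨r, hr, hr0⟩ := intermediate_value_Icc (a := (5 : ℝ)) (b := m + 3) (by linarith)
    hcont.continuousOn (show (0 : ℝ) ∈ _ from ⟨by nlinarith, by nlinarith [sq_nonneg (m : ℝ)]⟩)
  simp only at hr0
  have hr5 : 5 < r := by
    refine lt_of_le_of_ne hr.1 ?_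
    rintro rfl
    linarith
  refine ⟨r, hr5, ?_, ?_⟩
  · push_cast
    linarith
  · refine le_csSup (finite_setOf_mulVec_eq_smul _).bddAbove
      ⟨_, ?_, starPlus_adjMat_mulVec (by linarith) hr0⟩
    exact fun h => one_ne_zero (congrFun h 1)

theorem nonempty_iso_starPlus {V : Type*} [Fintype V] {G : SimpleGraph V} {n : ℕ}
    (hn : Fintype.card V = n) (h3 : 3 ≤ n) {u a b : V} (hua : G.Adj u a) (hub : G.Adj u b)
    (hab : G.Adj a b) (hall : ∀ v, v ≠ u → G.Adj u v)
    (huniq : ∀ v w, G.Adj u v → G.Adj u w → G.Adj v w → s(v, w) = s(a, b)) :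
    Nonempty (G ≃g starPlus n) := by
  obtain ⟨m, rfl⟩ : ∃ m, n = m + 3 := ⟨n - 3, by omega⟩
  obtain ⟨e, he0, he1, he2⟩ : ∃ e : V ≃ Fin (m + 3), e u = 0 ∧ e a = 1 ∧ e b = ⟨2, by omega⟩ := by
    have e₀ := Fintype.equivFinOfCardEq hn
    obtain ⟨e₁, h₁⟩ : ∃ e : V ≃ Fin (m + 3), e u = 0 :=
      ⟨e₀.trans (Equiv.swap (e₀ u) 0), by simp⟩
    have h01 : (0 : Fin (m + 3)) ≠ 1 := by simp
    have h02 : (0 : Fin (m + 3)) ≠ ⟨2, by omega⟩ := by simp [Fin.ext_iff]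
    have h12 : (1 : Fin (m + 3)) ≠ ⟨2, by omega⟩ := by simp [Fin.ext_iff]
    obtain ⟨e₂, h₂, h₂'⟩ : ∃ e : V ≃ Fin (m + 3), e u = 0 ∧ e a = 1 := by
      refine ⟨e₁.trans (Equiv.swap (e₁ a) 1), ?_, by simp⟩
      rw [Equiv.trans_apply, Equiv.swap_apply_of_ne_of_ne, h₁]
      · exact e₁.injective.ne hua.ne
      · rwa [h₁]
    refine ⟨e₂.trans (Equiv.swap (e₂ b) ⟨2, by omega⟩), ?_, ?_, by simp⟩
    · rw [Equiv.trans_apply, Equiv.swap_apply_of_ne_of_ne, h₂]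
      · exact e₂.injective.ne hub.ne
      · rwa [h₂]
    · rw [Equiv.trans_apply, Equiv.swap_apply_of_ne_of_ne, h₂']
      · exact e₂.injective.ne hab.ne
      · rwa [h₂']
  have hu : ∀ v, (e v).val = 0 ↔ v = u := fun v => by
    rw [← e.injective.eq_iff, he0, Fin.ext_iff]; rfl
  have ha : ∀ v, (e v).val = 1 ↔ v = a := fun v => by
    rw [← e.injective.eq_iff, he1, Fin.ext_iff]; simp
  have hb : ∀ v, (e v).val = 2 ↔ v = b := fun v => by
    rw [← e.injective.eq_iff, he2, Fin.ext_iff]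
  refine ⟨⟨e, fun {v w} => ?_⟩⟩
  have hlt : ∀ v, (e v).val < 3 ↔ v = u ∨ v = a ∨ v = b := fun v => by
    rw [← hu, ← ha, ← hb]; omega
  change (starPlus (m + 3)).Adj (e v) (e w) ↔ G.Adj v w
  rw [starPlus_adj, hu, hu, hlt, hlt, Fin.val_ne_iff, e.injective.ne_iff]
  simp only [Sym2.eq_iff] at huniq
  have := huniq v w
  have := hall v
  have := hall w
  have h4 : G.Adj v w → v ≠ w := fun h => h.ne
  have := G.adj_comm
  grind

theorem stmt10 {V : Type*} [Fintype V] [DecidableEq V] (G : SimpleGraph V)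
    (n : ℕ) (hn : Fintype.card V = n) (h26 : 26 ≤ n)
    (h : specRad G ≥ specRad (starPlus n)) :
    HasTwoCyclesSameLength G ∨ Nonempty (G ≃g starPlus n) := by
  classical
  by_cases hG : HasTwoCyclesSameLength G
  · exact Or.inl hG
  refine Or.inr ?_
  subst hn
  obtain ⟨r, hr5, hr, hle⟩ := exists_le_specRad_starPlus h26
  obtain ⟨l, hl, hrl⟩ : ∃ l, l = specRad G ∧ r ≤ l := ⟨_, rfl, hle.trans h⟩
  have hmem : l ∈ {t : ℝ | ∃ x : V → ℝ, x ≠ 0 ∧ (adjMat G).mulVec x = t • x} := by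
    rw [hl]
    refine Set.Nonempty.csSup_mem ?_ (finite_setOf_mulVec_eq_smul _)
    by_contra hne
    rw [specRad, Set.not_nonempty_iff_eq_empty.1 hne, Real.sSup_empty] at hl
    linarith
  obtain ⟨x, hx, hlx⟩ := hmem
  obtain ⟨y, u, hy⟩ := SimpleGraph.exists_subEigen_of_mulVec_eq hx (by linarith) hlx
  have hpos : 0 ≤ r ^ 2 - (Fintype.card V - 1) := by
    by_contra hneg
    nlinarith
  have hsq : r ^ 2 ≤ l ^ 2 := by gcongr
  have hrl' : (r ^ 2 - (Fintype.card V - 1)) * (r - 1) ≤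
      (l ^ 2 - (Fintype.card V - 1)) * (l - 1) :=
    mul_le_mul (by linarith) (by linarith) (by linarith) (by linarith)
  obtain ⟨a, b, hua, hub, hab, hall⟩ := SimpleGraph.exists_triangle_of_subEigen hG hy (by linarith)
    (hr.trans hrl')
  refine nonempty_iso_starPlus rfl (by omega) hua hub hab hall fun v w hv hw hvw => ?_
  obtain ⟨c₁, h₁, l₁, e₁⟩ := SimpleGraph.exists_cycle_three hv hvw hw.symm
  obtain ⟨c₂, h₂, l₂, e₂⟩ := SimpleGraph.exists_cycle_three hua hab hub.symm
  have := SimpleGraph.edges_subset_of_length_eq hG h₁ h₂ (l₁.trans l₂.symm) (e := s(v, w))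
    (by simp [e₁])
  simp only [e₂, List.mem_cons, List.not_mem_nil, or_false, Sym2.eq_iff] at this
  have h1 := hv.ne
  have h2 := hw.ne
  simp only [Sym2.eq_iff]
  grind
end

section
/- Every graph G of order n ≥ 17 with ρ(G) ≥ ρ(K_4 • K_{1,n−4}) contains two edge-disjoint cycles, unless G is isomorphic to K_4 • K_{1,n−4}. -/
open Finset

open Classical in
/-- The adjacency indicator of a graph, with values in `ℕ`. -/
noncomputable def adjInd {V : Type*} (G : SimpleGraph V) (v w : V) : ℕ :=
  if G.Adj v w then 1 else 0

section Indicator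

variable {V : Type*} (G : SimpleGraph V)

lemma adjInd_of_adj {G : SimpleGraph V} {v w : V} (h : G.Adj v w) : adjInd G v w = 1 := if_pos h

lemma adjInd_of_not_adj {G : SimpleGraph V} {v w : V} (h : ¬ G.Adj v w) : adjInd G v w = 0 :=
  if_neg h

lemma adjInd_symm (v w : V) : adjInd G v w = adjInd G w v := by
  by_cases h : G.Adj v w
  · rw [adjInd_of_adj h, adjInd_of_adj h.symm]
  · rw [adjInd_of_not_adj h, adjInd_of_not_adj fun h' => h h'.symm]

lemma adjInd_self (v : V) : adjInd G v v = 0 := by simp [adjInd]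

lemma sum_adjInd_insert [DecidableEq V] {S : Finset V} {x : V} (hx : x ∉ S) :
    ∑ v ∈ insert x S, ∑ w ∈ insert x S, adjInd G v w =
      2 * ∑ w ∈ S, adjInd G x w + ∑ v ∈ S, ∑ w ∈ S, adjInd G v w := by
  simp only [sum_insert hx, adjInd_self, sum_add_distrib, adjInd_symm G _ x]
  ring

lemma sum_adjInd_union [DecidableEq V] {S T : Finset V} (h : Disjoint S T) :
    ∑ v ∈ S ∪ T, ∑ w ∈ S ∪ T, adjInd G v w =
      ∑ v ∈ S, ∑ w ∈ S, adjInd G v w + 2 * ∑ v ∈ T, ∑ w ∈ S, adjInd G v w +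
        ∑ v ∈ T, ∑ w ∈ T, adjInd G v w := by
  simp only [sum_union h, sum_add_distrib]
  have : ∑ v ∈ S, ∑ w ∈ T, adjInd G v w = ∑ v ∈ T, ∑ w ∈ S, adjInd G v w := by
    rw [sum_comm]
    simp only [adjInd_symm G]
  omega

lemma even_sum_adjInd (S : Finset V) : Even (∑ v ∈ S, ∑ w ∈ S, adjInd G v w) := by
  classical
  induction S using Finset.induction with
  | empty => simp
  | insert x S hx ih =>
    rw [sum_adjInd_insert G hx]
    exact (even_two_mul _).add ih

lemma two_mul_sum_adjInd_le {S : Finset V} {x : V} (hx : x ∈ S) :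
    2 * ∑ w ∈ S, adjInd G x w ≤ ∑ v ∈ S, ∑ w ∈ S, adjInd G v w := by
  classical
  rw [← insert_erase hx, sum_adjInd_insert G (notMem_erase x S),
    sum_insert (notMem_erase x S), adjInd_self]
  omega

lemma exists_adj_of_sum_adjInd_pos {S : Finset V} {x : V} (h : 0 < ∑ w ∈ S, adjInd G x w) :
    ∃ w ∈ S, G.Adj x w := by
  obtain ⟨w, hw, hpos⟩ := exists_ne_zero_of_sum_ne_zero h.ne'
  exact ⟨w, hw, by_contra fun hn => hpos (adjInd_of_not_adj hn)⟩

open Classical in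
lemma sum_adjInd_eq_card (S : Finset V) (x : V) :
    ∑ w ∈ S, adjInd G x w = #{w ∈ S | G.Adj x w} := by
  rw [card_filter]
  rfl

/-- A forest spans at most `#S - 1` edges inside a nonempty set `S` of vertices. -/
lemma SimpleGraph.IsAcyclic.sum_adjInd_add_two_le {F : SimpleGraph V} (hF : F.IsAcyclic)
    {S : Finset V} (hS : S.Nonempty) :
    ∑ v ∈ S, ∑ w ∈ S, adjInd F v w + 2 ≤ 2 * #S := by
  classical
  have : Nonempty S := hS.to_subtype
  let H : SimpleGraph S := F.induce (S : Set V)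
  have hH : H.IsAcyclic := hF.induce (S : Set V)
  obtain ⟨T, hHT, -, hT⟩ :=
    SimpleGraph.connected_top.exists_isTree_le_of_le_of_isAcyclic le_top hH
  have hcard := hT.card_edgeFinset
  have hle : #H.edgeFinset ≤ #T.edgeFinset :=
    card_le_card (SimpleGraph.edgeFinset_mono hHT)
  have hdeg := H.sum_degrees_eq_twice_card_edges
  have hsum : ∑ v ∈ S, ∑ w ∈ S, adjInd F v w = ∑ v : S, H.degree v := by
    rw [← sum_coe_sort S]
    refine sum_congr rfl fun v _ => ?_
    rw [← SimpleGraph.card_neighborFinset_eq_degree, SimpleGraph.neighborFinset_eq_filter,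
      card_filter, ← sum_coe_sort S]
    rfl
  rw [Fintype.card_coe] at hcard
  omega

end Indicator

section Cycles

variable {V : Type*} {G : SimpleGraph V}

lemma SimpleGraph.Adj.exists_isCycle_three {a b c : V} (hab : G.Adj a b) (hbc : G.Adj b c)
    (hca : G.Adj c a) :
    ∃ p : G.Walk a a, p.IsCycle ∧ p.edges = [s(a, b), s(b, c), s(c, a)] := by
  refine ⟨.cons hab (.cons hbc (.cons hca .nil)), ?_, rfl⟩
  have := hab.ne
  have := hbc.ne
  have := hca.ne
  simp [SimpleGraph.Walk.cons_isCycle_iff, SimpleGraph.Walk.cons_isPath_iff]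
  grind

lemma SimpleGraph.Adj.exists_isCycle_four {a b c d : V} (hab : G.Adj a b) (hbc : G.Adj b c)
    (hcd : G.Adj c d) (hda : G.Adj d a) (hac : a ≠ c) (hbd : b ≠ d) :
    ∃ p : G.Walk a a, p.IsCycle ∧ p.edges = [s(a, b), s(b, c), s(c, d), s(d, a)] := by
  refine ⟨.cons hab (.cons hbc (.cons hcd (.cons hda .nil))), ?_, rfl⟩
  have := hab.ne
  have := hbc.ne
  have := hcd.ne
  have := hda.ne
  simp [SimpleGraph.Walk.cons_isCycle_iff, SimpleGraph.Walk.cons_isPath_iff]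
  grind

lemma HasTwoEdgeDisjointCycles.of_triangles {u a b c d : V} (hua : G.Adj u a) (hub : G.Adj u b)
    (huc : G.Adj u c) (hud : G.Adj u d) (hab : G.Adj a b) (hcd : G.Adj c d)
    (hac : a ≠ c) (had : a ≠ d) (hbc : b ≠ c) (hbd : b ≠ d) :
    HasTwoEdgeDisjointCycles G := by
  obtain ⟨p, hp, hpe⟩ := hua.exists_isCycle_three hab hub.symm
  obtain ⟨q, hq, hqe⟩ := huc.exists_isCycle_three hcd hud.symm
  refine ⟨u, u, p, q, hp, hq, ?_⟩
  have := hua.ne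
  have := hub.ne
  have := huc.ne
  have := hud.ne
  intro e he he'
  rw [hpe] at he
  rw [hqe] at he'
  simp only [List.mem_cons, List.not_mem_nil, or_false] at he he'
  rcases he with rfl | rfl | rfl <;> rcases he' with h | h | h <;>
    rw [Sym2.eq_iff] at h <;> tauto

lemma HasTwoEdgeDisjointCycles.of_claw {u a b c d : V} (hua : G.Adj u a) (hub : G.Adj u b)
    (huc : G.Adj u c) (hud : G.Adj u d) (hab : G.Adj a b) (hac : G.Adj a c) (had : G.Adj a d)
    (hbc : b ≠ c) (hbd : b ≠ d) (hcd : c ≠ d) :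
    HasTwoEdgeDisjointCycles G := by
  obtain ⟨p, hp, hpe⟩ := hua.exists_isCycle_three hab hub.symm
  obtain ⟨q, hq, hqe⟩ := huc.exists_isCycle_four hac.symm had hud.symm hua.ne hcd
  refine ⟨u, u, p, q, hp, hq, ?_⟩
  have := hua.ne
  have := hub.ne
  have := huc.ne
  have := hud.ne
  have := hab.ne
  have := hac.ne
  have := had.ne
  intro e he he'
  rw [hpe] at he
  rw [hqe] at he'
  simp only [List.mem_cons, List.not_mem_nil, or_false] at he he'
  rcases he with rfl | rfl | rfl <;> rcases he' with h | h | h | h <;>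
    rw [Sym2.eq_iff] at h <;> tauto

lemma HasTwoEdgeDisjointCycles.of_four_common {u w : V} (huw : u ≠ w) {T : Finset V}
    (hT : 4 ≤ #T) (hu : ∀ v ∈ T, G.Adj u v) (hw : ∀ v ∈ T, G.Adj w v) :
    HasTwoEdgeDisjointCycles G := by
  classical
  obtain ⟨T', hT', hcard⟩ := exists_subset_card_eq hT
  obtain ⟨a, b, c, d, hab, hac, had, hbc, hbd, hcd, rfl⟩ := card_eq_four.mp hcard
  simp only [insert_subset_iff, singleton_subset_iff] at hT'
  obtain ⟨ha, hb, hc, hd⟩ := hT'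
  obtain ⟨p, hp, hpe⟩ :=
    (hu a ha).exists_isCycle_four (hw a ha).symm (hw b hb) (hu b hb).symm huw hab
  obtain ⟨q, hq, hqe⟩ :=
    (hu c hc).exists_isCycle_four (hw c hc).symm (hw d hd) (hu d hd).symm huw hcd
  refine ⟨u, u, p, q, hp, hq, ?_⟩
  have := (hu a ha).ne
  have := (hu b hb).ne
  have := (hu c hc).ne
  have := (hu d hd).ne
  have := (hw a ha).ne
  have := (hw b hb).ne
  have := (hw c hc).ne
  have := (hw d hd).ne
  clear hu hw hT hcard
  intro e he he'
  rw [hpe] at he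
  rw [hqe] at he'
  simp only [List.mem_cons, List.not_mem_nil, or_false] at he he'
  rcases he with rfl | rfl | rfl | rfl <;> rcases he' with h | h | h | h <;>
    rw [Sym2.eq_iff] at h <;> tauto

/-- If all cycles of `G` pairwise share an edge, then `G` spans at most `#S - 1 + k` edges inside
a nonempty vertex set `S`, where `k` is the length of any cycle. -/
lemma sum_adjInd_add_two_le_of_isCycle (hG : ¬ HasTwoEdgeDisjointCycles G) {x : V}
    {p : G.Walk x x} (hp : p.IsCycle) {S : Finset V} (hS : S.Nonempty) :
    ∑ v ∈ S, ∑ w ∈ S, adjInd G v w + 2 ≤ 2 * (#S + p.length) := by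
  classical
  have hF : (G.deleteEdges p.edgeSet).IsAcyclic := by
    intro y q hq
    refine hG ⟨y, x, q.mapLe (G.deleteEdges_le _), p, hq.mapLe _, hp, fun e he => ?_⟩
    have he' : e ∈ q.edges := by simpa using he
    have := q.edges_subset_edgeSet he'
    rw [SimpleGraph.edgeSet_deleteEdges] at this
    exact this.2
  have hsingle (e : Sym2 V) : ∑ v ∈ S, ∑ w ∈ S, (if s(v, w) = e then 1 else 0) ≤ 2 := by
    induction e using Sym2.ind with
    | _ a b =>
      calc _ ≤ ∑ v ∈ S, ∑ w ∈ S, ((if v = a then if w = b then 1 else 0 else 0) +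
              (if v = b then if w = a then 1 else 0 else 0)) := by
            gcongr with v _ w _
            simp only [Sym2.eq_iff]
            grind
        _ = (∑ v ∈ S, if v = a then ∑ w ∈ S, (if w = b then 1 else 0) else 0) +
              ∑ v ∈ S, if v = b then ∑ w ∈ S, (if w = a then 1 else 0) else 0 := by
            simp only [sum_add_distrib]
            congr 1 <;> refine sum_congr rfl fun v _ => ?_ <;> split_ifs <;> simp
        _ ≤ 1 + 1 := by
            simp only [sum_ite_eq']
            gcongr <;> split_ifs <;> simp
  have hlist (l : List (Sym2 V)) :
      ∑ v ∈ S, ∑ w ∈ S, (if s(v, w) ∈ l then 1 else 0) ≤ 2 * l.length := by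
    induction l with
    | nil => simp
    | cons e l ih =>
      calc _ ≤ ∑ v ∈ S, ∑ w ∈ S, ((if s(v, w) = e then 1 else 0) +
              (if s(v, w) ∈ l then 1 else 0)) := by
            gcongr with v _ w _
            simp only [List.mem_cons]
            grind
        _ ≤ 2 + 2 * l.length := by
            simp only [sum_add_distrib]
            exact add_le_add (hsingle e) ih
        _ = _ := by simp; ring
  have hsplit : ∑ v ∈ S, ∑ w ∈ S, adjInd G v w ≤
      ∑ v ∈ S, ∑ w ∈ S, (adjInd (G.deleteEdges p.edgeSet) v w +
        if s(v, w) ∈ p.edges then 1 else 0) := by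
    gcongr with v _ w _
    simp only [adjInd, SimpleGraph.deleteEdges_adj, SimpleGraph.Walk.mem_edgeSet]
    grind
  have h1 := hF.sum_adjInd_add_two_le hS
  have h2 := hlist p.edges
  rw [SimpleGraph.Walk.length_edges] at h2
  simp only [sum_add_distrib] at hsplit
  omega

end Cycles

section Neighbourhood

variable {V : Type*} [Fintype V] (G : SimpleGraph V) (u : V)

open Classical in
/-- The neighbours of `u`. -/
noncomputable def near : Finset V := {v | G.Adj u v}

open Classical in
/-- The vertices at distance at least two from `u`. -/
noncomputable def far : Finset V := {v | v ≠ u ∧ ¬ G.Adj u v}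

/-- The number of common neighbours of `u` and `w`. -/
noncomputable def codeg (w : V) : ℕ := ∑ v ∈ near G u, adjInd G w v

/-- The number of neighbours of `w` at distance at least two from `u`. -/
noncomputable def fardeg (w : V) : ℕ := ∑ v ∈ far G u, adjInd G w v

variable {G u}

lemma mem_near {v : V} : v ∈ near G u ↔ G.Adj u v := by simp [near]

lemma mem_far {v : V} : v ∈ far G u ↔ v ≠ u ∧ ¬ G.Adj u v := by simp [far]

variable (G u)

lemma disjoint_near_far : Disjoint (near G u) (far G u) :=
  disjoint_left.mpr fun _ h h' => (mem_far.mp h').2 (mem_near.mp h)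

lemma self_notMem_near_union_far [DecidableEq V] : u ∉ near G u ∪ far G u := by
  simp [mem_near, mem_far]

lemma insert_near_union_far [DecidableEq V] : insert u (near G u ∪ far G u) = univ := by
  ext v
  simp only [mem_insert, mem_union, mem_near, mem_far, mem_univ]
  tauto

lemma sum_univ_eq_near_far {M : Type*} [AddCommMonoid M] (f : V → M) :
    ∑ v, f v = f u + (∑ v ∈ near G u, f v + ∑ v ∈ far G u, f v) := by
  classical
  rw [← insert_near_union_far G u, sum_insert (self_notMem_near_union_far G u),
    sum_union (disjoint_near_far G u)]

lemma card_eq_near_far : Fintype.card V = 1 + (#(near G u) + #(far G u)) := by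
  have := sum_univ_eq_near_far G u fun _ => 1
  simpa using this

variable {G u}

lemma codeg_near_add_le (hG : ¬ HasTwoEdgeDisjointCycles G) {x : V} {p : G.Walk x x}
    (hp : p.IsCycle) {T : Finset V} (hT : T ⊆ far G u) :
    ∑ v ∈ near G u, codeg G u v + 2 * ∑ w ∈ T, codeg G u w +
      ∑ v ∈ T, ∑ w ∈ T, adjInd G v w ≤ 2 * (#T + p.length) := by
  classical
  have hdisj : Disjoint (near G u) T := (disjoint_near_far G u).mono_right hT
  have hu : u ∉ near G u ∪ T := fun h =>
    self_notMem_near_union_far G u (union_subset_union_right hT h)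
  have key := sum_adjInd_add_two_le_of_isCycle hG hp (insert_nonempty u (near G u ∪ T))
  rw [sum_adjInd_insert G hu, sum_adjInd_union G hdisj, card_insert_of_notMem hu,
    card_union_of_disjoint hdisj, sum_union hdisj] at key
  have hN : ∑ v ∈ near G u, adjInd G u v = #(near G u) := by
    rw [card_eq_sum_ones]
    exact sum_congr rfl fun v hv => adjInd_of_adj (mem_near.mp hv)
  unfold codeg
  omega

lemma codeg_le_two (hG : ¬ HasTwoEdgeDisjointCycles G) {a : V} (ha : G.Adj u a) :
    codeg G u a ≤ 2 := by
  classical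
  by_contra! h
  rw [codeg, sum_adjInd_eq_card] at h
  obtain ⟨b, hb, c, hc, d, hd, hbc, hbd, hcd⟩ := two_lt_card.mp h
  simp only [mem_filter, mem_near] at hb hc hd
  exact hG (.of_claw ha hb.1 hc.1 hd.1 hb.2 hc.2 hd.2 hbc hbd hcd)

lemma codeg_le_three (hG : ¬ HasTwoEdgeDisjointCycles G) {w : V} (hw : w ∈ far G u) :
    codeg G u w ≤ 3 := by
  classical
  by_contra! h
  rw [codeg, sum_adjInd_eq_card] at h
  refine hG (.of_four_common (mem_far.mp hw).1.symm h ?_ ?_) <;>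
    simp +contextual [mem_near]

lemma exists_isCycle_of_two_le_codeg {w : V} (hw : w ∈ far G u) (h : 2 ≤ codeg G u w) :
    ∃ p : G.Walk u u, p.IsCycle ∧ p.length = 4 := by
  classical
  rw [codeg, sum_adjInd_eq_card] at h
  obtain ⟨a, ha, b, hb, hab⟩ := one_lt_card.mp h
  simp only [mem_filter, mem_near] at ha hb
  obtain ⟨p, hp, hpe⟩ :=
    ha.1.exists_isCycle_four ha.2.symm hb.2 hb.1.symm (mem_far.mp hw).1.symm hab
  exact ⟨p, hp, by rw [← p.length_edges, hpe]; rfl⟩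

lemma exists_isCycle_of_codeg_pos {a : V} (ha : G.Adj u a) (h : 0 < codeg G u a) :
    ∃ p : G.Walk u u, p.IsCycle ∧ p.length = 3 := by
  obtain ⟨b, hb, hab⟩ := exists_adj_of_sum_adjInd_pos G h
  obtain ⟨p, hp, hpe⟩ := ha.exists_isCycle_three hab (mem_near.mp hb).symm
  exact ⟨p, hp, by rw [← p.length_edges, hpe]; rfl⟩

/-- Counting data for the vertices at distance at least two from `u`: `A` of them share a
neighbour with `u` and `B` do not, `f` is the number of edges inside the first class and `g` the
number of edges between the classes, and `s` is the excess of the codegrees over `A`. -/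
lemma exists_far_counts {m k : ℕ} (hcm : ∀ w ∈ far G u, codeg G u w ≤ m)
    (hk : ∀ T ⊆ far G u, ∑ v ∈ near G u, codeg G u v + 2 * ∑ w ∈ T, codeg G u w +
      ∑ v ∈ T, ∑ w ∈ T, adjInd G v w ≤ 2 * (#T + k)) :
    ∃ A B s f g : ℕ, #(far G u) = A + B ∧ (B = 0 → g = 0) ∧ (A = 0 → g = 0) ∧
      s + A ≤ m * A ∧ (0 < f → 2 ≤ A) ∧
      ∑ v ∈ near G u, codeg G u v + 2 * (s + f) ≤ 2 * k ∧
      ∑ v ∈ near G u, codeg G u v + 2 * (s + f + g) ≤ 2 * (k + B) ∧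
      ∑ w ∈ far G u, codeg G u w * (codeg G u w + fardeg G u w) ≤
        (m + 1) * s + A + (2 + s) * f + m * g := by
  classical
  set S := {w ∈ far G u | codeg G u w ≠ 0} with hS
  set T := {w ∈ far G u | ¬ codeg G u w ≠ 0} with hT
  have hST : Disjoint S T := disjoint_filter_filter_not _ _ _
  have hfar : S ∪ T = far G u := filter_union_filter_not_eq _ _
  have hSf : S ⊆ far G u := filter_subset _ _
  have hT0 : ∀ w ∈ T, codeg G u w = 0 := fun w hw => by simpa using (mem_filter.mp hw).2
  have hS1 : ∀ w ∈ S, 1 ≤ codeg G u w := fun w hw =>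
    Nat.one_le_iff_ne_zero.mpr (mem_filter.mp hw).2
  obtain ⟨f, hf⟩ := even_sum_adjInd G S
  set s := ∑ w ∈ S, (codeg G u w - 1) with hs
  have hsum : ∑ w ∈ S, codeg G u w = s + #S := by
    rw [hs, card_eq_sum_ones, ← sum_add_distrib]
    exact sum_congr rfl fun w hw => (Nat.sub_add_cancel (hS1 w hw)).symm
  have hcross : ∑ w ∈ S, ∑ z ∈ T, adjInd G w z = ∑ w ∈ T, ∑ z ∈ S, adjInd G w z := by
    rw [sum_comm]
    simp only [adjInd_symm G]
  set g := ∑ w ∈ S, ∑ z ∈ T, adjInd G w z with hg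
  have h1 := hk S hSf
  have h2 := hk (far G u) subset_rfl
  rw [← hfar, sum_adjInd_union G hST, sum_union hST, sum_eq_zero hT0,
    card_union_of_disjoint hST] at h2
  refine ⟨#S, #T, s, f, g, by rw [← hfar, card_union_of_disjoint hST], fun h => ?_, fun h => ?_,
    ?_, fun h => ?_, by omega, by omega, ?_⟩
  · simp [hg, card_eq_zero.mp h]
  · simp [hg, card_eq_zero.mp h]
  · rw [← hsum, mul_comm]
    exact sum_le_card_nsmul _ _ _ fun w hw => hcm w (hSf hw)
  · by_contra! hA
    have hle := card_le_one.mp (Nat.lt_succ_iff.mp hA)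
    have : ∑ v ∈ S, ∑ w ∈ S, adjInd G v w = 0 :=
      sum_eq_zero fun v hv => sum_eq_zero fun w hw => by rw [hle v hv w hw, adjInd_self]
    omega
  · have hterm : ∀ w ∈ S, codeg G u w * (codeg G u w + fardeg G u w) ≤
        (m + 1) * (codeg G u w - 1) + 1 + (∑ z ∈ S, adjInd G w z + (codeg G u w - 1) * f) +
          m * ∑ z ∈ T, adjInd G w z := by
      intro w hw
      have hmul := two_mul_sum_adjInd_le G hw
      have hsplit : fardeg G u w = ∑ z ∈ S, adjInd G w z + ∑ z ∈ T, adjInd G w z := by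
        rw [fardeg, ← hfar, sum_union hST]
      obtain ⟨e, he⟩ := Nat.exists_eq_add_of_le (hS1 w hw)
      have hm' := hcm w (hSf hw)
      have hle : ∑ z ∈ S, adjInd G w z ≤ f := by omega
      rw [hsplit, he]
      rw [he] at hm'
      generalize ∑ z ∈ S, adjInd G w z = x at *
      generalize ∑ z ∈ T, adjInd G w z = y at *
      have e1 : e * x ≤ e * f := Nat.mul_le_mul_left _ hle
      have e2 : (1 + e) * y ≤ m * y := Nat.mul_le_mul_right _ hm'
      have e3 : e * e + e ≤ m * e := by nlinarith
      rw [Nat.add_sub_cancel_left]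
      nlinarith
    calc ∑ w ∈ far G u, codeg G u w * (codeg G u w + fardeg G u w)
        = ∑ w ∈ S, codeg G u w * (codeg G u w + fardeg G u w) := by
          rw [← hfar, sum_union hST, sum_eq_zero (s := T) fun w hw => by rw [hT0 w hw, zero_mul],
            add_zero]
      _ ≤ _ := sum_le_sum hterm
      _ = _ := by
          simp only [sum_add_distrib, ← mul_sum, ← sum_mul, ← hs, ← hg, hf, sum_const]
          simp only [smul_eq_mul]
          ring

end Neighbourhood

section Spectral

variable {V : Type*} [Fintype V] {G : SimpleGraph V}

lemma adjMat_mulVec_apply (x : V → ℝ) (v : V) :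
    (adjMat G).mulVec x v = ∑ w, (adjInd G v w : ℝ) * x w := by
  simp only [Matrix.mulVec, dotProduct, adjMat, adjInd, Matrix.of_apply]
  push_cast
  rfl

lemma finite_eigenvalues (G : SimpleGraph V) :
    {t : ℝ | ∃ x : V → ℝ, x ≠ 0 ∧ (adjMat G).mulVec x = t • x}.Finite := by
  classical
  refine (Module.End.finite_hasEigenvalue (Matrix.toLin' (adjMat G))).subset ?_
  rintro t ⟨x, hx, h⟩
  exact Module.End.hasEigenvalue_of_hasEigenvector
    (Module.End.hasEigenvector_iff.mpr ⟨Module.End.mem_eigenspace_iff.mpr h, hx⟩)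

lemma le_specRad {t : ℝ} {x : V → ℝ} (hx : x ≠ 0) (h : (adjMat G).mulVec x = t • x) :
    t ≤ specRad G :=
  le_csSup (finite_eigenvalues G).bddAbove ⟨x, hx, h⟩

/-- A positive lower bound `t` for the spectral radius is witnessed by a vector in `[0, 1]^V`
attaining the value `1` that the adjacency matrix stretches by at least `t`. -/
lemma exists_subinvariant {t : ℝ} (ht : 0 < t) (h : t ≤ specRad G) :
    ∃ (y : V → ℝ) (u : V), (∀ v, 0 ≤ y v) ∧ (∀ v, y v ≤ 1) ∧ y u = 1 ∧
      ∀ v, t * y v ≤ ∑ w, (adjInd G v w : ℝ) * y w := by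
  have hne : {t : ℝ | ∃ x : V → ℝ, x ≠ 0 ∧ (adjMat G).mulVec x = t • x}.Nonempty := by
    by_contra! hemp
    rw [specRad, hemp, Real.sSup_empty] at h
    exact h.not_gt ht
  obtain ⟨x, hx, hxeq⟩ := hne.csSup_mem (finite_eigenvalues G)
  change (adjMat G).mulVec x = specRad G • x at hxeq
  obtain ⟨v₀, hv₀⟩ := Function.ne_iff.mp hx
  have : Nonempty V := ⟨v₀⟩
  obtain ⟨u, hu⟩ := Finite.exists_max fun v => |x v|
  have hpos : 0 < |x u| := (abs_pos.mpr hv₀).trans_le (hu v₀)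
  refine ⟨fun v => |x v| / |x u|, u, fun v => by positivity, fun v => div_le_one_of_le₀ (hu v)
    hpos.le, div_self hpos.ne', fun v => ?_⟩
  have hv : specRad G * x v = ∑ w, (adjInd G v w : ℝ) * x w := by
    rw [← adjMat_mulVec_apply, hxeq]
    rfl
  calc t * (|x v| / |x u|) ≤ specRad G * (|x v| / |x u|) := by gcongr
    _ = |specRad G * x v| / |x u| := by
        rw [abs_mul, abs_of_pos (ht.trans_le h), mul_div_assoc]
    _ ≤ (∑ w, (adjInd G v w : ℝ) * |x w|) / |x u| := by
        rw [hv]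
        gcongr
        refine (abs_sum_le_sum_abs _ _).trans_eq (sum_congr rfl fun w _ => ?_)
        rw [abs_mul, Nat.abs_cast]
    _ = _ := by
        rw [sum_div]
        exact sum_congr rfl fun w _ => mul_div_assoc _ _ _

variable {u : V} {y : V → ℝ} {t : ℝ}

lemma sum_near_mul_le (hy1 : ∀ v, y v ≤ 1) (v : V) :
    ∑ w ∈ near G u, (adjInd G v w : ℝ) * y w ≤ codeg G u v := by
  rw [codeg, Nat.cast_sum]
  exact sum_le_sum fun w _ => mul_le_of_le_one_right (Nat.cast_nonneg _) (hy1 w)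

lemma sum_codeg_mul (S : Finset V) :
    ∑ v ∈ near G u, ∑ w ∈ S, (adjInd G v w : ℝ) * y w = ∑ w ∈ S, (codeg G u w : ℝ) * y w := by
  rw [sum_comm]
  refine sum_congr rfl fun w _ => ?_
  rw [codeg, Nat.cast_sum, sum_mul]
  simp only [adjInd_symm G w]

/-- Iterating the eigenvalue inequality twice from a vertex of maximum weight. -/
lemma sq_le_near_add (hu : y u = 1) (ht : 0 ≤ t)
    (h : ∀ v, t * y v ≤ ∑ w, (adjInd G v w : ℝ) * y w) :
    t ^ 2 ≤ #(near G u) + (∑ v ∈ near G u, (codeg G u v : ℝ) * y v +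
      ∑ w ∈ far G u, (codeg G u w : ℝ) * y w) := by
  have h1 : t ≤ ∑ v ∈ near G u, y v := by
    have := h u
    rw [sum_univ_eq_near_far G u, hu, adjInd_self,
      sum_eq_zero (s := far G u) fun w hw => by
        rw [adjInd_of_not_adj (mem_far.mp hw).2, Nat.cast_zero, zero_mul]] at this
    refine (by simpa using this : t ≤ _).trans_eq (sum_congr rfl fun v hv => ?_)
    rw [adjInd_of_adj (mem_near.mp hv), Nat.cast_one, one_mul]
  calc t ^ 2 = t * t := sq t
    _ ≤ t * ∑ v ∈ near G u, y v := by gcongr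
    _ ≤ ∑ v ∈ near G u, (1 + (∑ w ∈ near G u, (adjInd G v w : ℝ) * y w +
          ∑ w ∈ far G u, (adjInd G v w : ℝ) * y w)) := by
        rw [mul_sum]
        refine sum_le_sum fun v hv => (h v).trans_eq ?_
        rw [sum_univ_eq_near_far G u, hu, adjInd_of_adj (mem_near.mp hv).symm]
        simp
    _ = _ := by
        simp only [sum_add_distrib, sum_codeg_mul]
        simp

lemma mul_sub_le_near_add_far (hy : ∀ v, 0 ≤ y v) (hy1 : ∀ v, y v ≤ 1) (hu : y u = 1) {M : ℕ}
    (hM : ∀ v ∈ near G u, codeg G u v ≤ M) (hMt : M ≤ t)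
    (h : ∀ v, t * y v ≤ ∑ w, (adjInd G v w : ℝ) * y w) :
    (t - M) * (t ^ 2 - #(near G u)) ≤ ∑ v ∈ near G u, (codeg G u v : ℝ) +
      ∑ w ∈ far G u, (codeg G u w : ℝ) * (codeg G u w + fardeg G u w) := by
  have ht : 0 ≤ t := (Nat.cast_nonneg M).trans hMt
  have h1 := sq_le_near_add hu ht h
  set X := ∑ v ∈ near G u, (codeg G u v : ℝ) * y v with hX
  set Z := ∑ w ∈ far G u, (codeg G u w : ℝ) * y w with hZ
  have hXle : t * X ≤ ∑ v ∈ near G u, (codeg G u v : ℝ) + M * (X + Z) := by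
    calc t * X = ∑ v ∈ near G u, (codeg G u v : ℝ) * (t * y v) := by
          rw [hX, mul_sum]
          exact sum_congr rfl fun v _ => by ring
      _ ≤ ∑ v ∈ near G u, ((codeg G u v : ℝ) + M * (∑ w ∈ near G u, (adjInd G v w : ℝ) * y w +
            ∑ w ∈ far G u, (adjInd G v w : ℝ) * y w)) := by
          refine sum_le_sum fun v hv => ?_
          have hv' := h v
          rw [sum_univ_eq_near_far G u, hu, adjInd_of_adj (mem_near.mp hv).symm] at hv'
          have hS : 0 ≤ ∑ w ∈ near G u, (adjInd G v w : ℝ) * y w +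
              ∑ w ∈ far G u, (adjInd G v w : ℝ) * y w := by
            refine add_nonneg (sum_nonneg fun w _ => ?_) (sum_nonneg fun w _ => ?_) <;>
              exact mul_nonneg (Nat.cast_nonneg _) (hy w)
          have hc : (codeg G u v : ℝ) ≤ M := by exact_mod_cast hM v hv
          calc _ ≤ (codeg G u v : ℝ) * (1 + (∑ w ∈ near G u, (adjInd G v w : ℝ) * y w +
                ∑ w ∈ far G u, (adjInd G v w : ℝ) * y w)) := by
                gcongr
                simpa using hv'
            _ ≤ _ := by
                rw [mul_add, mul_one]
                gcongr
      _ = _ := by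
          simp only [sum_add_distrib, ← mul_sum, sum_codeg_mul, ← hX, ← hZ]
  have hZle : t * Z ≤ ∑ w ∈ far G u, (codeg G u w : ℝ) * (codeg G u w + fardeg G u w) := by
    rw [hZ, mul_sum]
    refine sum_le_sum fun w hw => ?_
    have hw' := h w
    rw [sum_univ_eq_near_far G u,
      adjInd_of_not_adj fun h' => (mem_far.mp hw).2 h'.symm] at hw'
    have hfar : ∑ z ∈ far G u, (adjInd G w z : ℝ) * y z ≤ fardeg G u w := by
      rw [fardeg, Nat.cast_sum]
      exact sum_le_sum fun z _ => mul_le_of_le_one_right (Nat.cast_nonneg _) (hy1 z)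
    have hnear := sum_near_mul_le (G := G) (u := u) hy1 w
    calc t * (codeg G u w * y w) = codeg G u w * (t * y w) := by ring
      _ ≤ _ := by
          gcongr
          simp only [Nat.cast_zero, zero_mul, zero_add] at hw'
          linarith
  have h2 : (t - M) * (t ^ 2 - #(near G u)) ≤ (t - M) * (X + Z) := by
    have := sub_nonneg.mpr hMt
    gcongr
    linarith
  linarith

end Spectral

section Extremal

lemma exists_gt_four_root {n : ℕ} (hn : 17 ≤ n) :
    ∃ t : ℝ, 4 < t ∧ (t ^ 2 - (n - 1)) * (t - 2) = 6 := by
  have hn' : (17 : ℝ) ≤ n := by exact_mod_cast hn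
  have hcont : ContinuousOn (fun t : ℝ => (t ^ 2 - (n - 1)) * (t - 2)) (Set.Icc 4 n) := by
    fun_prop
  obtain ⟨t, ⟨ht, -⟩, h⟩ := intermediate_value_Icc (by linarith) hcont
    (show (6 : ℝ) ∈ Set.Icc _ _ by constructor <;> nlinarith)
  refine ⟨t, ht.lt_of_ne ?_, h⟩
  rintro rfl
  simp only at h
  linarith

lemma le_specRad_K4Star {n : ℕ} (hn : 4 ≤ n) {t : ℝ} (ht : 4 < t)
    (h : (t ^ 2 - (n - 1)) * (t - 2) = 6) : t ≤ specRad (K4Star n) := by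
  obtain ⟨m, rfl⟩ := Nat.exists_eq_add_of_le' hn
  let ξ : ℕ → ℝ := fun i => if i = 0 then 1 else if i < 4 then (t - 2)⁻¹ else t⁻¹
  have hadj (v w : Fin (m + 4)) : (adjInd (K4Star (m + 4)) v w : ℝ) =
      if v.val ≠ w.val ∧ (v.val = 0 ∨ w.val = 0 ∨ v.val < 4 ∧ w.val < 4) then 1 else 0 := by
    unfold adjInd K4Star
    simp only [SimpleGraph.fromRel_adj, Nat.cast_ite, Nat.cast_one, Nat.cast_zero, ne_eq,
      Fin.ext_iff]
    congr 1
    grind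
  refine le_specRad (x := fun v => ξ v) (fun h0 => ?_) (funext fun v => ?_)
  · simpa [ξ] using congrFun h0 0
  · have ht0 : t ≠ 0 := by linarith
    have ht2 : t - 2 ≠ 0 := by linarith
    push_cast at h
    rw [adjMat_mulVec_apply]
    simp only [hadj, Pi.smul_apply, smul_eq_mul]
    rw [Fin.sum_univ_eq_sum_range (fun i => (if v.val ≠ i ∧
      (v.val = 0 ∨ i = 0 ∨ v.val < 4 ∧ i < 4) then (1 : ℝ) else 0) * ξ i)]
    simp only [sum_range_succ']
    generalize v.val = k
    have hlt (i : ℕ) : ¬ i + 1 + 1 + 1 + 1 < 4 := by omega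
    match k with
    | 0 =>
      simp [ξ, hlt]
      field_simp
      linarith
    | 1 | 2 | 3 =>
      simp [ξ, hlt]
      field_simp
      ring
    | k + 4 =>
      simp [ξ, ht0, hlt]

variable {V : Type*} [Fintype V] {G : SimpleGraph V} {u : V} {y : V → ℝ} {t : ℝ}

lemma far_bound_zero {j A B s f g q : ℕ} (hj : j = A + B) (hB : B = 0 → g = 0) (hA : A = 0 → g = 0)
    (hs : s + A ≤ 3 * A) (hf : 0 < f → 2 ≤ A) (h : s + f ≤ 4) (hg : s + f + g ≤ 4 + B)
    (hq : q ≤ (3 + 1) * s + A + (2 + s) * f + 3 * g) :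
    q ≤ 4 * j + 10 ∨ 2 ≤ j ∧ q ≤ 4 * j + 11 := by
  have : s ≤ 4 := by omega
  have : f ≤ 4 := by omega
  interval_cases s <;> interval_cases f <;> omega

lemma far_bound_one {j A B s f g q : ℕ} (hj : j = A + B)
    (hs : s + A ≤ 3 * A) (hf : 0 < f → 2 ≤ A) (h : s + f ≤ 2) (hg : s + f + g ≤ 2 + B)
    (hq : q ≤ (3 + 1) * s + A + (2 + s) * f + 3 * g) :
    q ≤ 3 * j + 6 := by
  have : s ≤ 2 := by omega
  have : f ≤ 2 := by omega
  interval_cases s <;> interval_cases f <;> omega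

lemma far_bound_two {j A B s f g q : ℕ} (hj : j = A + B) (hA : A = 0 → g = 0)
    (hs : s + A ≤ 2 * A) (hf : 0 < f → 2 ≤ A) (h : s + f ≤ 1) (hg : s + f + g ≤ 1 + B)
    (hq : q ≤ (2 + 1) * s + A + (2 + s) * f + 2 * g) :
    q = 0 ∨ 1 ≤ j ∧ q ≤ 2 * j + 2 := by
  have : s ≤ 1 := by omega
  have : f ≤ 1 := by omega
  interval_cases s <;> interval_cases f <;> omega

/-- If all cycles pairwise share an edge and the spectral radius is at least that of
`K₄ • K_{1,n-4}`, a vertex of maximum weight dominates and its neighbours span three edges. -/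
lemma far_eq_empty_and_sum_codeg (hG : ¬ HasTwoEdgeDisjointCycles G) (ht : 4 < t)
    (hroot : (t ^ 2 - ((Fintype.card V : ℝ) - 1)) * (t - 2) = 6)
    (hy : ∀ v, 0 ≤ y v) (hy1 : ∀ v, y v ≤ 1) (hu : y u = 1)
    (h : ∀ v, t * y v ≤ ∑ w, (adjInd G v w : ℝ) * y w) :
    far G u = ∅ ∧ ∑ v ∈ near G u, codeg G u v = 6 := by
  have hcard := card_eq_near_far G u
  obtain ⟨p, hp⟩ : ∃ p, p = ∑ v ∈ near G u, codeg G u v := ⟨_, rfl⟩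
  obtain ⟨q, hq⟩ : ∃ q, q = ∑ w ∈ far G u, codeg G u w * (codeg G u w + fardeg G u w) := ⟨_, rfl⟩
  obtain ⟨j, hj⟩ : ∃ j, j = #(far G u) := ⟨_, rfl⟩
  obtain ⟨e, he⟩ : ∃ e, e = t ^ 2 - ((Fintype.card V : ℝ) - 1) := ⟨_, rfl⟩
  have hsq : t ^ 2 - #(near G u) = j + e := by
    rw [he, hcard, hj]
    push_cast
    ring
  rw [← he] at hroot
  have he0 : 0 < e := by
    by_contra! hneg
    nlinarith
  have hspec (M : ℕ) (hM : ∀ v ∈ near G u, codeg G u v ≤ M) (hM4 : M ≤ 4) :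
      (t - M) * (j + e) ≤ p + q := by
    have hM4' : (M : ℝ) ≤ 4 := by exact_mod_cast hM4
    have := mul_sub_le_near_add_far hy hy1 hu hM (by linarith) h
    rw [hsq] at this
    rw [hp, hq]
    exact_mod_cast this
  have hj0 : (0 : ℝ) ≤ j := Nat.cast_nonneg j
  rcases Nat.eq_zero_or_pos p with hp0 | hp0
  · exfalso
    have hc0 : ∀ v ∈ near G u, codeg G u v = 0 := sum_eq_zero_iff.mp (hp.symm.trans hp0)
    by_cases hfar : ∀ w ∈ far G u, codeg G u w ≤ 1
    · have h1 := sq_le_near_add hu (by linarith) h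
      rw [sum_eq_zero (s := near G u) fun v hv => by rw [hc0 v hv, Nat.cast_zero, zero_mul],
        zero_add] at h1
      have h2 : ∑ w ∈ far G u, (codeg G u w : ℝ) * y w ≤ j := by
        rw [hj, card_eq_sum_ones, Nat.cast_sum]
        refine sum_le_sum fun w hw => ?_
        have : (codeg G u w : ℝ) ≤ 1 := by exact_mod_cast hfar w hw
        rw [Nat.cast_one]
        exact mul_le_one₀ this (hy w) (hy1 w)
      linarith
    · push Not at hfar
      obtain ⟨w, hw, hcw⟩ := hfar
      obtain ⟨c, hc, hc4⟩ := exists_isCycle_of_two_le_codeg hw hcw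
      obtain ⟨A, B, s, f, g, h1, h2, h3, h4, h5, h6, h7, h8⟩ :=
        exists_far_counts (fun w hw => codeg_le_three hG hw) (k := 4)
          (fun T hT => hc4 ▸ codeg_near_add_le hG hc hT)
      rw [← hp] at h6 h7
      rw [← hq] at h8
      have hj1 : 1 ≤ j := by
        rw [hj]
        exact card_pos.mpr ⟨w, hw⟩
      have hspec0 := hspec 0 (fun v hv => (hc0 v hv).le) (by norm_num)
      have hj1' : (1 : ℝ) ≤ j := by exact_mod_cast hj1
      rw [hp0] at hspec0
      push_cast at hspec0
      rcases far_bound_zero (hj.trans h1) h2 h3 h4 h5 (by omega) (by omega) h8 with hb | ⟨hj2, hb⟩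
      · have hb' : (q : ℝ) ≤ 4 * j + 10 := by exact_mod_cast hb
        nlinarith [sq_nonneg (t - 5)]
      · have hb' : (q : ℝ) ≤ 4 * j + 11 := by exact_mod_cast hb
        have hj2' : (2 : ℝ) ≤ j := by exact_mod_cast hj2
        nlinarith [sq_nonneg (t - 5)]
  · obtain ⟨a, ha, hca⟩ := exists_ne_zero_of_sum_ne_zero (hp ▸ hp0.ne')
    obtain ⟨c, hc, hc3⟩ :=
      exists_isCycle_of_codeg_pos (mem_near.mp ha) (Nat.pos_of_ne_zero hca)
    have hk := fun T (hT : T ⊆ far G u) => hc3 ▸ codeg_near_add_le hG hc hT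
    obtain ⟨d, hd⟩ : Even p := hp ▸ even_sum_adjInd G (near G u)
    have hd3 : d ≤ 3 := by
      have := hk ∅ (empty_subset _)
      rw [← hp] at this
      simp at this
      omega
    have hfar : ∀ w ∈ far G u, codeg G u w ≤ 4 - d := fun w hw => by
      have := hk {w} (singleton_subset_iff.mpr hw)
      rw [← hp] at this
      simp [adjInd_self] at this
      omega
    have hnear : ∀ v ∈ near G u, codeg G u v ≤ d := fun v hv => by
      have := two_mul_sum_adjInd_le G hv
      change 2 * codeg G u v ≤ ∑ v ∈ near G u, codeg G u v at this
      omega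
    have hnear2 : ∀ v ∈ near G u, codeg G u v ≤ 2 := fun v hv =>
      codeg_le_two hG (mem_near.mp hv)
    obtain ⟨A, B, s, f, g, h1, h2, h3, h4, h5, h6, h7, h8⟩ := exists_far_counts hfar hk
    rw [← hp] at h6 h7 ⊢
    rw [← hq] at h8
    rw [← card_eq_zero, ← hj]
    rw [← hj] at h1
    have hd1 : 1 ≤ d := by omega
    interval_cases d
    · exfalso
      have hb := far_bound_one h1 h4 h5 (by omega) (by omega) h8
      have hspec1 := hspec 1 hnear (by norm_num)
      rw [hd] at hspec1
      push_cast at hspec1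
      have hb' : (q : ℝ) ≤ 3 * j + 6 := by exact_mod_cast hb
      rcases Nat.eq_zero_or_pos j with hj' | hj'
      · have hq0 : (q : ℝ) ≤ 0 := by
          rw [hj, card_eq_zero] at hj'
          simp [hq, hj']
        subst hj'
        push_cast at *
        nlinarith
      · have hj1' : (1 : ℝ) ≤ j := by exact_mod_cast hj'
        have : (t - 4) * 1 ≤ (t - 4) * j := by gcongr
        nlinarith [sq_nonneg (t - 4)]
    · exfalso
      have hb := far_bound_two h1 h3 h4 h5 (by omega) (by omega) h8
      have hspec2 := hspec 2 hnear (by norm_num)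
      rw [hd] at hspec2
      push_cast at hspec2
      rcases hb with hb | ⟨hj', hb⟩
      · rw [hb] at hspec2
        push_cast at hspec2
        nlinarith
      · have hb' : (q : ℝ) ≤ 2 * j + 2 := by exact_mod_cast hb
        have hj1' : (1 : ℝ) ≤ j := by exact_mod_cast hj'
        nlinarith
    · have hb : q ≤ j := by
        have : s = 0 := by omega
        have : f = 0 := by omega
        subst s f
        omega
      have hspec3 := hspec 2 hnear2 (by norm_num)
      rw [hd] at hspec3
      push_cast at hspec3
      have hb' : (q : ℝ) ≤ j := by exact_mod_cast hb
      refine ⟨?_, hd⟩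
      by_contra hj'
      have hj1' : (1 : ℝ) ≤ j := by exact_mod_cast Nat.one_le_iff_ne_zero.mpr hj'
      nlinarith

end Extremal

section Structure

variable {V : Type*} [Fintype V] {G : SimpleGraph V} {u : V}

lemma exists_common_neighbor_ne {v a : V} (h : 2 ≤ codeg G u v) :
    ∃ w, w ≠ a ∧ G.Adj u w ∧ G.Adj v w := by
  classical
  rw [codeg, sum_adjInd_eq_card] at h
  obtain ⟨w, hw, hwa⟩ := exists_mem_ne h a
  simp only [mem_filter, mem_near] at hw
  exact ⟨w, hwa, hw⟩

lemma exists_K4_of_path (hG : ¬ HasTwoEdgeDisjointCycles G)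
    (h6 : ∑ v ∈ near G u, codeg G u v = 6) {a b c : V} (ha : G.Adj u a) (hb : G.Adj u b)
    (hc : G.Adj u c) (hab : G.Adj a b) (hac : G.Adj a c) (hbc : b ≠ c) :
    G.Adj b c ∧ ∀ v w, G.Adj u v → G.Adj u w → G.Adj v w → v = a ∨ v = b ∨ v = c := by
  classical
  have hsupp (v w : V) (hv : G.Adj u v) (hw : G.Adj u w) (hvw : G.Adj v w) :
      v = a ∨ v = b ∨ v = c := by
    by_contra! hne
    have hwb : w = a ∨ w = b := by
      by_contra! hwne
      exact hG (.of_triangles ha hb hv hw hab hvw hne.1.symm hwne.1.symm hne.2.1.symm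
        hwne.2.symm)
    have hwc : w = a ∨ w = c := by
      by_contra! hwne
      exact hG (.of_triangles ha hc hv hw hac hvw hne.1.symm hwne.1.symm hne.2.2.symm
        hwne.2.symm)
    have hwa : w = a := by grind
    subst hwa
    exact hG (.of_claw ha hb hc hv hab hac hvw.symm hbc hne.2.1.symm hne.2.2.symm)
  refine ⟨?_, hsupp⟩
  have hsub : ({a, b, c} : Finset V) ⊆ near G u := by
    simp [insert_subset_iff, mem_near, ha, hb, hc]
  rw [← sum_subset hsub fun v hv hvabc => by
    by_contra hpos
    obtain ⟨w, hw, hvw⟩ := exists_adj_of_sum_adjInd_pos G (Nat.pos_of_ne_zero hpos)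
    have := hsupp v w (mem_near.mp hv) (mem_near.mp hw) hvw
    simp only [mem_insert, mem_singleton] at hvabc
    exact hvabc this, sum_insert (by simp [hab.ne, hac.ne]), sum_pair hbc] at h6
  have ha2 := codeg_le_two hG ha
  have hb2 := codeg_le_two hG hb
  have hc2 := codeg_le_two hG hc
  obtain ⟨w, hwa, huw, hbw⟩ :=
    exists_common_neighbor_ne (G := G) (u := u) (v := b) (a := a) (by omega)
  rcases hsupp w b huw hb hbw.symm with rfl | rfl | rfl
  · exact absurd rfl hwa
  · exact absurd hbw G.irrefl
  · exact hbw

/-- If the neighbours of `u` span three edges and all cycles pairwise share an edge, then these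
three edges form a triangle. -/
lemma exists_K4 (hG : ¬ HasTwoEdgeDisjointCycles G)
    (h6 : ∑ v ∈ near G u, codeg G u v = 6) :
    ∃ a b c, G.Adj u a ∧ G.Adj u b ∧ G.Adj u c ∧ G.Adj a b ∧ G.Adj a c ∧ G.Adj b c ∧
      ∀ v w, G.Adj u v → G.Adj u w → G.Adj v w → v = a ∨ v = b ∨ v = c := by
  classical
  obtain ⟨a, ha, b, hb, hab⟩ : ∃ a, G.Adj u a ∧ ∃ b, G.Adj u b ∧ G.Adj a b := by
    obtain ⟨a, ha, hca⟩ := exists_ne_zero_of_sum_ne_zero (h6.trans_ne (by norm_num))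
    obtain ⟨b, hb, hab⟩ := exists_adj_of_sum_adjInd_pos G (Nat.pos_of_ne_zero hca)
    exact ⟨a, mem_near.mp ha, b, mem_near.mp hb, hab⟩
  obtain ⟨c, hc, hca, hcb, w, hw, hcw⟩ :
      ∃ c, G.Adj u c ∧ c ≠ a ∧ c ≠ b ∧ ∃ w, G.Adj u w ∧ G.Adj c w := by
    by_contra! hno
    have hsub : ({a, b} : Finset V) ⊆ near G u := by
      simp [insert_subset_iff, mem_near, ha, hb]
    rw [← sum_subset hsub fun v hv hvab => by
      by_contra hpos
      obtain ⟨w, hw, hvw⟩ := exists_adj_of_sum_adjInd_pos G (Nat.pos_of_ne_zero hpos)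
      simp only [mem_insert, mem_singleton, not_or] at hvab
      exact hno v (mem_near.mp hv) hvab.1 hvab.2 w (mem_near.mp hw) hvw,
      sum_pair hab.ne] at h6
    have ha2 := codeg_le_two hG ha
    have hb2 := codeg_le_two hG hb
    omega
  have hwab : w = a ∨ w = b := by
    by_contra! hwne
    exact hG (.of_triangles ha hb hc hw hab hcw hca.symm hwne.1.symm hcb.symm hwne.2.symm)
  rcases hwab with rfl | rfl
  · obtain ⟨hbc, hsupp⟩ := exists_K4_of_path hG h6 ha hb hc hab hcw.symm hcb.symm
    exact ⟨w, b, c, ha, hb, hc, hab, hcw.symm, hbc, hsupp⟩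
  · obtain ⟨hac, hsupp⟩ := exists_K4_of_path hG h6 hb ha hc hab.symm hcw.symm hca.symm
    exact ⟨w, a, c, hb, ha, hc, hab.symm, hcw.symm, hac, hsupp⟩

lemma nonempty_iso_K4Star {n : ℕ} (hn : Fintype.card V = n) (h4 : 4 ≤ n) {a b c : V}
    (hu : ∀ v, v ≠ u → G.Adj u v) (hab : G.Adj a b) (hac : G.Adj a c) (hbc : G.Adj b c)
    (ha : G.Adj u a) (hb : G.Adj u b) (hc : G.Adj u c)
    (hsupp : ∀ v w, G.Adj u v → G.Adj u w → G.Adj v w → v = a ∨ v = b ∨ v = c) :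
    Nonempty (G ≃g K4Star n) := by
  classical
  let f : Fin n → V := fun i =>
    if i.val = 0 then u else if i.val = 1 then a else if i.val = 2 then b else c
  obtain ⟨e, he⟩ := Finset.exists_equiv_extend_of_card_eq (t := (univ : Finset V))
    (by rw [card_univ, hn, Fintype.card_fin]) (s := {i : Fin n | i.val < 4}) (f := f)
    (subset_univ _) (by
      intro i hi j hj hij
      have := ha.ne
      have := hb.ne
      have := hc.ne
      have := hab.ne
      have := hac.ne
      have := hbc.ne
      simp only [coe_filter, mem_univ, true_and, Set.mem_ofPred_eq] at hi hj
      simp only [f] at hij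
      apply Fin.ext
      grind)
  let e' : Fin n ≃ V := e.trans (Equiv.subtypeUnivEquiv mem_univ)
  have hval (k : Fin n) (hk : k.val < 4) (i : Fin n) : e' i = f k ↔ i.val = k.val := by
    rw [← show e' k = f k from he k (by simpa using hk), e'.injective.eq_iff, Fin.ext_iff]
  have h0 (i : Fin n) : e' i = u ↔ i.val = 0 := hval ⟨0, by omega⟩ (by simp) i
  have h1 (i : Fin n) : e' i = a ↔ i.val = 1 := hval ⟨1, by omega⟩ (by simp) i
  have h2 (i : Fin n) : e' i = b ↔ i.val = 2 := hval ⟨2, by omega⟩ (by simp) i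
  have h3 (i : Fin n) : e' i = c ↔ i.val = 3 := hval ⟨3, by omega⟩ (by simp) i
  have hadj (v w : V) : G.Adj v w ↔ v ≠ w ∧ (v = u ∨ w = u ∨
      (v = a ∨ v = b ∨ v = c) ∧ (w = a ∨ w = b ∨ w = c)) := by
    refine ⟨fun h => ⟨h.ne, ?_⟩, ?_⟩
    · by_cases hv : v = u
      · exact .inl hv
      · by_cases hw : w = u
        · exact .inr (.inl hw)
        · exact .inr (.inr ⟨hsupp v w (hu v hv) (hu w hw) h, hsupp w v (hu w hw) (hu v hv) h.symm⟩)
    · rintro ⟨hne, rfl | rfl | ⟨hv, hw⟩⟩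
      · exact hu w hne.symm
      · exact (hu v hne).symm
      · rcases hv with rfl | rfl | rfl <;> rcases hw with rfl | rfl | rfl <;>
          first | exact absurd rfl hne | assumption | (rw [G.adj_comm]; assumption)
  refine ⟨(RelIso.symm ⟨e', @fun i j => ?_⟩)⟩
  rw [hadj, h0, h0, h1, h2, h3, h1, h2, h3, e'.injective.ne_iff, K4Star,
    SimpleGraph.fromRel_adj, ne_eq, Fin.ext_iff]
  omega

end Structure

theorem stmt11 {V : Type*} [Fintype V] (G : SimpleGraph V)
    (n : ℕ) (hn : Fintype.card V = n) (h17 : 17 ≤ n)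
    (h : specRad G ≥ specRad (K4Star n)) :
    HasTwoEdgeDisjointCycles G ∨ Nonempty (G ≃g K4Star n) := by
  refine or_iff_not_imp_left.mpr fun hG => ?_
  obtain ⟨t, ht, hroot⟩ := exists_gt_four_root h17
  obtain ⟨y, u, hy, hy1, hyu, hle⟩ := exists_subinvariant (by linarith)
    ((le_specRad_K4Star (by omega) ht hroot).trans h)
  obtain ⟨hfar, h6⟩ := far_eq_empty_and_sum_codeg hG ht (hn ▸ hroot) hy hy1 hyu hle
  obtain ⟨a, b, c, ha, hb, hc, hab, hac, hbc, hsupp⟩ := exists_K4 hG h6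
  refine nonempty_iso_K4Star hn (by omega) (fun v hv => ?_) hab hac hbc ha hb hc hsupp
  by_contra hnadj
  exact notMem_empty v (hfar ▸ mem_far.mpr ⟨hv, hnadj⟩)
end
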